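/- arXiv:1703.08725 — 3 statements merged into one kernel-verified Lean document; each statement's English description precedes it below -/
import Mathlib

section
/- Let A be a finite dimensional algebra over an algebraically closed field k, let e be a primitive idempotent of A, and assume that Γ := (1-e)A(1-e) has finite global dimension. Then either Ext^i_A(S_e, S_e) is non-zero for infinitely many i, or Ext^i_A(S_e, S_e) = 0 for all i > 0. -/
set_option linter.unusedVariables false
set_option maxHeartbeats 1000000

/-! Common setup: corner rings, the simple module `S_e`, Ext-algebras (Yoneda rings),
semiperfect and basic rings, finite global dimension. -/

open CategoryTheory CategoryTheory.Abelian
open scoped DirectSum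

noncomputable section

/-- Smallness of Ext groups for module categories. -/
instance hasExtModuleCat (R : Type u) [Ring R] : HasExt.{u + 1} (ModuleCat.{u} R) :=
  letI := HasDerivedCategory.standard (ModuleCat.{u} R)
  hasExt_of_hasDerivedCategory _

/-! ### Corner rings `eAe` -/

/-- The corner ring `eAe = {x : A | e * x = x ∧ x * e = x}` of an idempotent `e : A`. -/
def CornerRing {A : Type*} [Ring A] (e : A) (_ : IsIdempotentElem e) : Type _ :=
  {x : A // e * x = x ∧ x * e = x}

namespace CornerRing

variable {A : Type*} [Ring A] {e : A} {he : IsIdempotentElem e}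

instance : Zero (CornerRing e he) := ⟨⟨0, by simp, by simp⟩⟩
instance : One (CornerRing e he) := ⟨⟨e, he, he⟩⟩
instance : Add (CornerRing e he) :=
  ⟨fun x y => ⟨x.1 + y.1, by rw [mul_add, x.2.1, y.2.1], by rw [add_mul, x.2.2, y.2.2]⟩⟩
instance : Neg (CornerRing e he) :=
  ⟨fun x => ⟨-x.1, by rw [mul_neg, x.2.1], by rw [neg_mul, x.2.2]⟩⟩
instance : Mul (CornerRing e he) :=
  ⟨fun x y => ⟨x.1 * y.1, by rw [← mul_assoc, x.2.1], by rw [mul_assoc, y.2.2]⟩⟩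

instance instRing : Ring (CornerRing e he) where
  add_assoc x y z := Subtype.ext (add_assoc _ _ _)
  zero_add x := Subtype.ext (zero_add _)
  add_zero x := Subtype.ext (add_zero _)
  add_comm x y := Subtype.ext (add_comm _ _)
  neg_add_cancel x := Subtype.ext (neg_add_cancel _)
  mul_assoc x y z := Subtype.ext (mul_assoc _ _ _)
  one_mul x := Subtype.ext x.2.1
  mul_one x := Subtype.ext x.2.2
  left_distrib x y z := Subtype.ext (left_distrib _ _ _)
  right_distrib x y z := Subtype.ext (right_distrib _ _ _)
  zero_mul x := Subtype.ext (zero_mul _)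
  mul_zero x := Subtype.ext (mul_zero _)
  nsmul := nsmulRec
  zsmul := zsmulRec

end CornerRing

/-! ### The semisimple module `S_e = eA / e rad A` -/

/-- The Jacobson radical of the ring `A`, as a set. -/
def ringRadical (A : Type*) [Ring A] : Set A :=
  ((⊥ : TwoSidedIdeal A).jacobson : Set A)

/-- The right ideal `eA`, as a right `A`-module (i.e. an `Aᵐᵒᵖ`-module). -/
def rightIdeal (A : Type*) [Ring A] (e : A) : Submodule Aᵐᵒᵖ A :=
  Submodule.span Aᵐᵒᵖ {e}

/-- The right submodule `e (rad A)` of `A`. -/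
def eRad (A : Type*) [Ring A] (e : A) : Submodule Aᵐᵒᵖ A :=
  Submodule.span Aᵐᵒᵖ ((e * ·) '' ringRadical A)

/-- The semisimple right `A`-module `S_e = eA / e rad A` associated with an idempotent `e`. -/
def SeModule (A : Type*) [Ring A] (e : A) : Type _ :=
  rightIdeal A e ⧸ (eRad A e).comap (rightIdeal A e).subtype

instance (A : Type*) [Ring A] (e : A) : AddCommGroup (SeModule A e) :=
  inferInstanceAs (AddCommGroup (rightIdeal A e ⧸ (eRad A e).comap (rightIdeal A e).subtype))

instance (A : Type*) [Ring A] (e : A) : Module Aᵐᵒᵖ (SeModule A e) :=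
  inferInstanceAs (Module Aᵐᵒᵖ (rightIdeal A e ⧸ (eRad A e).comap (rightIdeal A e).subtype))

/-- `S_e` as an object of the category of right `A`-modules. -/
def Se (A : Type) [Ring A] (e : A) : ModuleCat Aᵐᵒᵖ :=
  ModuleCat.of Aᵐᵒᵖ (SeModule A e)

/-! ### The Ext-algebra (Yoneda ring) of an object of an abelian category -/

namespace ExtYoneda

universe w v u
variable {C : Type u} [Category.{v} C] [Abelian C] [HasExt.{w} C]

lemma comp_heq {X Y Z : C} {a b c : ℕ} (h : a + b = c) (α : Ext X Y a) (β : Ext Y Z b) :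
    HEq (α.comp β rfl) (α.comp β h) := by subst h; rfl

variable (X : C)

def gmul : GradedMonoid.GMul (fun i : ℕ => Ext X X i) where
  mul {i j} α β := α.comp β rfl

def gone : GradedMonoid.GOne (fun i : ℕ => Ext X X i) where
  one := Ext.mk₀ (𝟙 X)

def gmonoid : GradedMonoid.GMonoid (fun i : ℕ => Ext X X i) :=
  letI := gmul X
  letI := gone X
  { one_mul := fun a => by
      obtain ⟨i, α⟩ := a
      exact Sigma.ext (zero_add i)
        ((comp_heq (zero_add i) _ _).trans (heq_of_eq (Ext.mk₀_id_comp α)))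
    mul_one := fun a => by
      obtain ⟨i, α⟩ := a
      exact Sigma.ext (add_zero i)
        ((comp_heq (add_zero i) _ _).trans (heq_of_eq (Ext.comp_mk₀_id α)))
    mul_assoc := fun a b c => by
      obtain ⟨i, α⟩ := a
      obtain ⟨j, β⟩ := b
      obtain ⟨k, γ⟩ := c
      refine Sigma.ext (add_assoc i j k) ?_
      refine (heq_of_eq (Ext.comp_assoc α β γ rfl rfl rfl)).trans ?_
      exact (comp_heq (h := (add_assoc i j k).symm ▸ rfl) _ _).symm }

/-- The graded ring structure on `fun i => Ext X X i` given by the Yoneda product. -/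
def gring : DirectSum.GRing (fun i : ℕ => Ext X X i) :=
  letI := gmonoid X
  { __ := gmonoid X
    mul_zero := fun {i j} α => Ext.comp_zero α _ _ _ rfl
    zero_mul := fun {i j} β => Ext.zero_comp _ _ β _ rfl
    mul_add := fun {_ _} α β γ => Ext.comp_add _ _ _ rfl
    add_mul := fun {_ _} α β γ => Ext.add_comp _ _ _ rfl
    natCast := fun n => n • Ext.mk₀ (𝟙 X)
    natCast_zero := zero_smul _ _
    natCast_succ := fun n => succ_nsmul _ _
    intCast := fun z => z • Ext.mk₀ (𝟙 X)
    intCast_ofNat := fun n => natCast_zsmul _ _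
    intCast_negSucc_ofNat := fun n => negSucc_zsmul _ _ }

end ExtYoneda

/-- The Yoneda (Ext-) ring `⨁ i, Ext X X i` of an object `X` of an abelian category,
with multiplication induced by the Yoneda product. -/
def ExtRing {C : Type u} [Category.{v} C] [Abelian C] [HasExt.{w} C] (X : C) : Type w :=
  ⨁ i : ℕ, Ext X X i

instance {C : Type u} [Category.{v} C] [Abelian C] [HasExt.{w} C] (X : C) :
    Ring (ExtRing X) :=
  letI := ExtYoneda.gring X
  inferInstanceAs (Ring (⨁ i : ℕ, Ext X X i))

/-- The Yoneda ring `Y(e) = Ext_A^*(S_e, S_e)` of an idempotent `e` of the ring `A`. -/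
def YonedaRing (A : Type) [Ring A] (e : A) : Type 1 :=
  ExtRing (Se A e)

instance (A : Type) [Ring A] (e : A) : Ring (YonedaRing A e) :=
  inferInstanceAs (Ring (ExtRing (Se A e)))

/-! ### Homological and ring-theoretic conditions -/

/-- A ring `R` has finite (right) global dimension if there is a uniform bound `n` such that
`Ext^i(M, N)` vanishes for all right `R`-modules `M`, `N` and all `i > n`. -/
def HasFiniteGlobalDimension (R : Type u) [Ring R] : Prop :=
  ∃ n : ℕ, ∀ (M N : ModuleCat.{u} Rᵐᵒᵖ) (i : ℕ), n < i → Subsingleton (Ext M N i)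

/-- A ring is Artinian on both sides. -/
def IsTwoSidedArtinian (R : Type u) [Ring R] : Prop :=
  IsArtinianRing R ∧ IsArtinianRing Rᵐᵒᵖ

/-- A ring is Noetherian on both sides. -/
def IsTwoSidedNoetherian (R : Type u) [Ring R] : Prop :=
  IsNoetherianRing R ∧ IsNoetherianRing Rᵐᵒᵖ

/-- A ring is semiperfect iff `1` decomposes as a finite sum of pairwise orthogonal
idempotents each of whose corner rings is local. -/
def IsSemiperfectRing (A : Type*) [Ring A] : Prop :=
  ∃ (n : ℕ) (f : Fin n → A) (hf : ∀ i, IsIdempotentElem (f i)),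
    (∀ i j, i ≠ j → f i * f j = 0) ∧ (∑ i, f i = 1) ∧
      ∀ i, IsLocalRing (CornerRing (f i) (hf i))

/-- An idempotent is primitive if it is nonzero and cannot be written as the sum of two
nonzero orthogonal idempotents. -/
def IsPrimitiveIdempotent {A : Type*} [Ring A] (e : A) : Prop :=
  IsIdempotentElem e ∧ e ≠ 0 ∧
    ∀ f g : A, IsIdempotentElem f → IsIdempotentElem g → f * g = 0 → g * f = 0 →
      f + g = e → f = 0 ∨ g = 0

/-- A ring is basic if `1` decomposes as a finite sum of pairwise orthogonal primitive
idempotents whose associated indecomposable projective right modules are pairwise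
non-isomorphic. -/
def IsBasicRing (A : Type*) [Ring A] : Prop :=
  ∃ (n : ℕ) (f : Fin n → A),
    (∀ i, IsPrimitiveIdempotent (f i)) ∧ (∀ i j, i ≠ j → f i * f j = 0) ∧ (∑ i, f i = 1) ∧
      ∀ i j, i ≠ j → IsEmpty ((rightIdeal A (f i)) ≃ₗ[Aᵐᵒᵖ] (rightIdeal A (f j)))

end
set_option maxHeartbeats 1000000
open CategoryTheory CategoryTheory.Abelian

lemma aux_mem_rad_of_nil {A : Type*} [Ring A] (x : A) (h : ∀ b, IsNilpotent (x * b)) :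
    x ∈ ringRadical A := by
  show x ∈ ((⊥ : TwoSidedIdeal A).jacobson)
  rw [TwoSidedIdeal.mem_jacobson_iff]
  intro y
  have h1 : IsNilpotent (y * x) := by
    obtain ⟨n, hn⟩ := h y
    refine ⟨n + 1, ?_⟩
    have : ∀ m : ℕ, (y * x) ^ (m + 1) = y * (x * y) ^ m * x := by
      intro m
      induction m with
      | zero => simp
      | succ m ih => rw [pow_succ, ih, pow_succ (x * y)]; simp only [mul_assoc]
    rw [this, hn]; simp
  obtain ⟨u, hu⟩ := h1.isUnit_one_add
  refine ⟨(↑u⁻¹ : A), ?_⟩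
  have h2 : (↑u⁻¹ : A) * (1 + y * x) = 1 := by rw [← hu]; simp
  rw [TwoSidedIdeal.mem_bot]
  rw [mul_add, mul_one] at h2
  rw [mul_assoc, sub_eq_zero, add_comm]
  exact h2

lemma aux_rad_eq_zero {A : Type*} [Ring A] {M : Type*} [AddCommGroup M] [Module Aᵐᵒᵖ M]
    (j : A) (hj : j ∈ ringRadical A) (a : A) (x : M) (hx : MulOpposite.op (j * a) • x = x) :
    x = 0 := by
  have hja : j * a ∈ ((⊥ : TwoSidedIdeal A).jacobson) := TwoSidedIdeal.mul_mem_right _ _ _ hj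
  have key : ∀ t ∈ ((⊥ : TwoSidedIdeal A).jacobson), ∃ z, z * (1 + t) = 1 := by
    intro t ht
    rw [TwoSidedIdeal.mem_jacobson_iff] at ht
    obtain ⟨z, hz⟩ := ht 1
    rw [TwoSidedIdeal.mem_bot, mul_one, sub_eq_zero] at hz
    exact ⟨z, by rw [mul_add, mul_one, add_comm]; exact hz⟩
  obtain ⟨z, hz⟩ := key (-(j * a)) (TwoSidedIdeal.neg_mem _ hja)
  obtain ⟨w, hw⟩ := key (z * (j * a)) (TwoSidedIdeal.mul_mem_left _ _ _ hja)
  have hz1 : 1 + z * (j * a) = z := by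
    have : z * (1 + -(j * a)) = z - z * (j * a) := by noncomm_ring
    rw [this] at hz
    rw [← hz]; abel
  rw [hz1] at hw
  have hwz : w = 1 + -(j * a) := by
    calc w = w * (z * (1 + -(j * a))) := by rw [hz, mul_one]
      _ = _ := by rw [← mul_assoc, hw, one_mul]
  have h3 : (1 + -(j * a)) * z = 1 := by rw [← hwz, hw]
  have h4 : MulOpposite.op (1 + -(j * a)) • x = 0 := by
    rw [MulOpposite.op_add, MulOpposite.op_neg, add_smul, neg_smul, hx]
    simp
  calc x = MulOpposite.op ((1 + -(j * a)) * z) • x := by rw [h3]; simp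
    _ = 0 := by rw [MulOpposite.op_mul, mul_smul, h4, smul_zero]

lemma aux_nil_or_unit (k : Type*) [Field k] {A : Type*} [Ring A] [Algebra k A]
    [FiniteDimensional k A] (e : A) (he : IsPrimitiveIdempotent e) (x : A) (h1 : e * x = x)
    (h2 : x * e = x) :
    IsNilpotent x ∨ ∃ y, e * y = y ∧ y * e = y ∧ x * y = e ∧ y * x = e := by
  obtain ⟨n, r, hr, hc, hec⟩ : ∃ (n : ℕ) (r : A), x ^ (n + 1) * r = x ^ n ∧ Commute x r ∧
      Commute e r := by
    have := Algebra.isMulCommutative_adjoin k (s := {x}) (by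
      intro a ha b hb; simp at ha hb; rw [ha, hb])
    have : IsArtinianRing (Algebra.adjoin k {x}) := IsArtinianRing.of_finite k _
    obtain ⟨n, y, hy⟩ := IsArtinian.exists_pow_succ_smul_dvd
      (⟨x, Algebra.self_mem_adjoin_singleton k x⟩ : Algebra.adjoin k {x})
      (1 : Algebra.adjoin k {x})
    have hcomm : ∀ c : A, Commute c x → Commute c y.1 := by
      intro c hcx
      have : Algebra.adjoin k {x} ≤ Subalgebra.centralizer k {c} := by
        rw [Algebra.adjoin_le_iff]
        intro z hz
        simp at hz
        subst hz
        rw [SetLike.mem_coe, Subalgebra.mem_centralizer_iff]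
        intro g hg
        simp at hg; subst hg
        exact hcx
      have := this y.2
      rw [Subalgebra.mem_centralizer_iff] at this
      exact this c rfl
    refine ⟨n, y.1, ?_, hcomm _ (Commute.refl x), hcomm e ?_⟩
    · have := congrArg Subtype.val hy
      simpa using this
    · show e * x = x * e
      rw [h1, h2]
  have hpow : ∀ m, x ^ (n + m) * r ^ m = x ^ n := by
    intro m
    induction m with
    | zero => simp
    | succ m ih =>
      rw [pow_succ' r, ← mul_assoc]
      have : x ^ (n + (m + 1)) * r = x ^ (n + m) := by
        have : n + (m + 1) = m + (n + 1) := by ring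
        rw [this, pow_add, mul_assoc, hr, ← pow_add, add_comm]
      rw [this, ih]
  have hN : x ^ (n + 1) * (x ^ (n + 1) * r ^ (n + 1)) = x ^ (n + 1) := by
    have := hpow (n + 1)
    calc _ = x * (x ^ (n + (n + 1)) * r ^ (n + 1)) := by
          rw [← mul_assoc, ← mul_assoc, ← pow_add, ← pow_succ']; congr 2; ring
      _ = _ := by rw [this, ← pow_succ']
  set g := x ^ (n + 1) * r ^ (n + 1) with hg
  have hcN : Commute (x ^ (n + 1)) (r ^ (n + 1)) := hc.pow_pow _ _
  have hgg : g * g = g := by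
    have hg' : g = r ^ (n + 1) * x ^ (n + 1) := by rw [hg, hcN.eq]
    calc g * g = r ^ (n + 1) * (x ^ (n + 1) * g) := by
            rw [← mul_assoc (r ^ (n + 1)), ← hg']
      _ = g := by rw [hN, ← hg']
  have heg : e * g = g := by
    rw [hg, pow_succ', mul_assoc, ← mul_assoc, h1]
  have hge : g * e = g := by
    rw [hg, hcN.eq, pow_succ x, mul_assoc, mul_assoc, h2]
  have hee : e * e = e := he.1
  rcases he.2.2 g (e - g) hgg (by
      show (e - g) * (e - g) = e - g
      rw [sub_mul, mul_sub, mul_sub, hee, heg, hge, hgg]; abel)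
    (by rw [mul_sub, hge, hgg, sub_self]) (by rw [sub_mul, heg, hgg, sub_self]) (by abel) with h | h
  · left
    exact ⟨n + 1, by rw [← hN, h, mul_zero]⟩
  · right
    have hge' : g = e := (sub_eq_zero.mp h).symm
    have hc1 : Commute (x ^ n * r ^ (n + 1)) x :=
      ((Commute.refl x).pow_left n).mul_left (hc.symm.pow_left _)
    have hc2 : Commute (x ^ n * r ^ (n + 1)) e := by
      have hex : Commute x e := by show x * e = e * x; rw [h1, h2]
      exact (hex.pow_left n).mul_left (hec.symm.pow_left _)
    have hx1 : x * (x ^ n * r ^ (n + 1)) = e := by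
      rw [← mul_assoc, ← pow_succ', ← hge']
    refine ⟨e * (x ^ n * r ^ (n + 1)), ?_, ?_, ?_, ?_⟩
    · rw [← mul_assoc, hee]
    · rw [mul_assoc, hc2.eq, ← mul_assoc, hee]
    · rw [← mul_assoc, h2, hx1]
    · rw [mul_assoc, hc1.eq, hx1, hee]

lemma aux_mem_rad_corner (k : Type*) [Field k] {A : Type*} [Ring A] [Algebra k A]
    [FiniteDimensional k A] (e : A) (he : IsPrimitiveIdempotent e) (x : A) (h1 : e * x = x)
    (h : ∀ b y, e * y = y → y * e = y → x * b * e * y ≠ e) : x ∈ ringRadical A := by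
  have hee : e * e = e := he.1
  apply aux_mem_rad_of_nil
  intro b
  rcases aux_nil_or_unit k e he (x * b * e) (by rw [← mul_assoc, ← mul_assoc, h1])
    (by rw [mul_assoc, hee]) with hn | ⟨y, hy1, hy2, hy3, hy4⟩
  · obtain ⟨n, hn⟩ := hn
    refine ⟨n + 1, ?_⟩
    have : ∀ m : ℕ, (x * b) ^ (m + 1) = (x * b * e) ^ m * (x * b) := by
      intro m
      induction m with
      | zero => simp
      | succ m ih =>
        rw [pow_succ, ih, pow_succ (x * b * e)]
        have : x * b * (x * b) = x * b * e * (x * b) := by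
          rw [mul_assoc (x * b) e, ← mul_assoc e, h1]
        rw [mul_assoc, this, ← mul_assoc]
    rw [this, hn, zero_mul]
  · exact absurd hy3 (h b y hy1 hy2)

lemma aux_corner_nil_mem (k : Type*) [Field k] {A : Type*} [Ring A] [Algebra k A]
    [FiniteDimensional k A] (e : A) (he : IsPrimitiveIdempotent e) (x : A) (h1 : e * x = x)
    (h2 : x * e = x) (hn : IsNilpotent x) : x ∈ ringRadical A := by
  apply aux_mem_rad_corner k e he x h1
  intro b y hy1 hy2 h
  obtain ⟨n, hn⟩ := hn
  have hz : x * (b * e * y) = e := by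
    conv_rhs => rw [← h]
    simp only [mul_assoc]
  set z := b * e * y
  have : ∀ m : ℕ, x ^ (m + 1) * z ^ (m + 1) = e := by
    intro m
    induction m with
    | zero => simpa using hz
    | succ m ih =>
      rw [pow_succ, pow_succ' z, mul_assoc, ← mul_assoc x, hz]
      rw [pow_succ x, mul_assoc, ← mul_assoc x e, h2, ← mul_assoc, ← pow_succ, ih]
  have h0 := this n
  rw [pow_succ x, hn] at h0
  exact he.2.1 (by rw [← h0]; simp)

lemma aux_mem_rightIdeal {A : Type*} [Ring A] (e x : A) (he : e * e = e) :
    x ∈ rightIdeal A e ↔ e * x = x := by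
  rw [rightIdeal, Submodule.mem_span_singleton]
  constructor
  · rintro ⟨a, rfl⟩
    show e * (e * a.unop) = e * a.unop
    rw [← mul_assoc, he]
  · intro h
    exact ⟨MulOpposite.op x, h⟩

lemma aux_mem_rad_offdiag (k : Type*) [Field k] {A : Type*} [Ring A] [Algebra k A]
    [FiniteDimensional k A] (e f : A) (he : IsPrimitiveIdempotent e)
    (hf : IsPrimitiveIdempotent f)
    (hiso : IsEmpty ((rightIdeal A e) ≃ₗ[Aᵐᵒᵖ] (rightIdeal A f))) (a : A) :
    e * a * f ∈ ringRadical A := by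
  have hee : e * e = e := he.1
  have hff : f * f = f := hf.1
  apply aux_mem_rad_corner k e he _ (by rw [← mul_assoc, ← mul_assoc, hee])
  intro b y hy1 hy2 h
  obtain ⟨u, hu⟩ : ∃ u, u = e * a * f := ⟨_, rfl⟩
  obtain ⟨v, hv⟩ : ∃ v, v = f * b * e * y := ⟨_, rfl⟩
  have heu : e * u = u := by rw [hu, ← mul_assoc, ← mul_assoc, hee]
  have huf : u * f = u := by rw [hu, mul_assoc, hff]
  have hfv : f * v = v := by rw [hv]; simp only [← mul_assoc, hff]
  have hve : v * e = v := by rw [hv, mul_assoc, hy2]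
  have huv : u * v = e := by
    rw [← h, hu, hv]; simp only [← mul_assoc]; rw [mul_assoc (e * a) f f, hff]
  have hidem : v * u * (v * u) = v * u := by
    rw [mul_assoc, ← mul_assoc u, huv, heu]
  have hfvu : f * (v * u) = v * u := by rw [← mul_assoc, hfv]
  have hvuf : v * u * f = v * u := by rw [mul_assoc, huf]
  rcases hf.2.2 (v * u) (f - v * u) hidem (by
      show (f - v * u) * (f - v * u) = f - v * u
      rw [sub_mul, mul_sub, mul_sub, hff, hfvu, hvuf, hidem]; abel)
    (by rw [mul_sub, hvuf, hidem, sub_self]) (by rw [sub_mul, hfvu, hidem, sub_self])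
    (by abel) with h0 | h0
  · apply he.2.1
    calc e = u * v * (u * v) := by rw [huv, hee]
      _ = u * (v * u) * v := by simp only [mul_assoc]
      _ = 0 := by rw [h0]; simp
  · have hvu : v * u = f := (sub_eq_zero.mp h0).symm
    refine hiso.false ⟨⟨⟨fun x => ⟨v * x.1, ?_⟩, ?_⟩, ?_⟩, fun x => ⟨u * x.1, ?_⟩, ?_, ?_⟩
    · rw [aux_mem_rightIdeal _ _ hff, ← mul_assoc, hfv]
    · intro x y; ext; exact mul_add _ _ _
    · intro r x; ext; exact (mul_assoc v x.1 r.unop).symm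
    · rw [aux_mem_rightIdeal _ _ hee, ← mul_assoc, heu]
    · intro x; ext
      show u * (v * x.1) = x.1
      rw [← mul_assoc, huv]
      exact (aux_mem_rightIdeal _ _ hee).mp x.2
    · intro x; ext
      show v * (u * x.1) = x.1
      rw [← mul_assoc, hvu]
      exact (aux_mem_rightIdeal _ _ hff).mp x.2

lemma aux_basic (k : Type*) [Field k] {A : Type*} [Ring A] [Algebra k A]
    [FiniteDimensional k A] (hA : IsBasicRing A) (e : A) (he : e * e = e) (a : A) :
    e * a * (1 - e) ∈ ringRadical A := by
  obtain ⟨n, f, hf, horth, hsum, hiso⟩ := hA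
  let J : TwoSidedIdeal A := (⊥ : TwoSidedIdeal A).jacobson
  let q : A →+* J.ringCon.Quotient := J.ringCon.mk'
  have hq : ∀ x, x ∈ ringRadical A ↔ q x = 0 := by
    intro x
    show x ∈ J ↔ _
    rw [TwoSidedIdeal.mem_iff]
    exact (RingCon.eq J.ringCon (a := x) (b := 0)).symm
  have hff : ∀ i, f i * f i = f i := fun i => (hf i).1
  have hcent : ∀ i a, q (f i) * q a = q (f i) * q a * q (f i) := by
    intro i a
    conv_lhs => rw [← mul_one (q (f i) * q a), ← map_one q, ← hsum, map_sum, Finset.mul_sum]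
    apply Finset.sum_eq_single
    · intro j _ hj
      rw [← map_mul, ← map_mul, ← hq]
      exact aux_mem_rad_offdiag k _ _ (hf i) (hf j) (hiso i j hj.symm) a
    · simp
  have hcent' : ∀ i a, q a * q (f i) = q (f i) * q a * q (f i) := by
    intro i a
    conv_lhs => rw [← one_mul (q a * q (f i)), ← map_one q, ← hsum, map_sum, Finset.sum_mul]
    simp only [← mul_assoc]
    apply Finset.sum_eq_single
    · intro j _ hj
      rw [← map_mul, ← map_mul, ← hq]
      exact aux_mem_rad_offdiag k _ _ (hf j) (hf i) (hiso j i hj) a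
    · simp
  have hcomm : ∀ i a, q (f i) * q a = q a * q (f i) := fun i a => by rw [hcent, hcent']
  have hqe : q e * q e = q e := by rw [← map_mul, he]
  have hqf : ∀ i, q (f i) * q (f i) = q (f i) := fun i => by rw [← map_mul, hff]
  have hfe : ∀ i, q (f i) * q e = 0 ∨ q (f i) * q e = q (f i) := by
    intro i
    have hx : q (f i * e * f i) = q (f i) * q e := by
      rw [map_mul, map_mul, ← hcent]
    rcases aux_nil_or_unit k (f i) (hf i) (f i * e * f i)
      (by simp only [← mul_assoc, hff]) (by simp only [mul_assoc, hff]) with h | ⟨y, _, _, h, _⟩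
    · left
      rw [← hx, ← hq]
      exact aux_corner_nil_mem k (f i) (hf i) _ (by simp only [← mul_assoc, hff])
        (by simp only [mul_assoc, hff]) h
    · right
      have h' := congrArg q h
      rw [map_mul, hx] at h'
      calc q (f i) * q e = q e * q (f i) := hcomm _ _
        _ = q e * (q (f i) * q e * q y) := by rw [h']
        _ = q e * (q e * q (f i) * q y) := by rw [hcomm i e]
        _ = q e * q (f i) * q y := by simp only [← mul_assoc, hqe]
        _ = q (f i) * q e * q y := by rw [hcomm i e]
        _ = _ := h'
  have hecent : ∀ a, q e * q a = q a * q e := by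
    intro a
    have h1 : q e = ∑ i, q (f i) * q e := by
      rw [← Finset.sum_mul, ← map_sum, hsum, map_one, one_mul]
    rw [h1, Finset.sum_mul, Finset.mul_sum]
    apply Finset.sum_congr rfl
    intro i _
    rcases hfe i with h | h
    · rw [h]; simp
    · rw [h]; exact hcomm i a
  rw [hq, map_mul, map_mul, hecent, mul_assoc, ← map_mul, mul_sub, mul_one, he, sub_self,
    map_zero, mul_zero]

lemma aux_eRad_le {A : Type*} [Ring A] (e x : A) (hx : x ∈ eRad A e) : x ∈ ringRadical A := by
  refine Submodule.span_induction (p := fun x _ => x ∈ ringRadical A) ?_ ?_ ?_ ?_ hx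
  · rintro _ ⟨j, hj, rfl⟩
    exact TwoSidedIdeal.mul_mem_left _ _ _ hj
  · exact TwoSidedIdeal.zero_mem _
  · intro x y _ _ hx hy
    exact TwoSidedIdeal.add_mem _ hx hy
  · intro a x _ hx
    exact TwoSidedIdeal.mul_mem_right _ _ _ hx

lemma aux_mem_eRad {A : Type*} [Ring A] (e x : A) (hx : x ∈ ringRadical A) (h : e * x = x) :
    x ∈ eRad A e :=
  Submodule.subset_span ⟨x, hx, h⟩

lemma aux_Se_smul (k : Type*) [Field k] {A : Type*} [Ring A] [Algebra k A]
    [FiniteDimensional k A] (hA : IsBasicRing A) (e : A) (he : IsPrimitiveIdempotent e)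
    (s : SeModule A e) : MulOpposite.op (1 - e) • s = 0 := by
  have hee : e * e = e := he.1
  obtain ⟨⟨x, hx⟩, rfl⟩ := Submodule.Quotient.mk_surjective _ s
  rw [aux_mem_rightIdeal _ _ hee] at hx
  refine (Submodule.Quotient.mk_eq_zero _).mpr ?_
  rw [Submodule.mem_comap]
  show x * (1 - e) ∈ eRad A e
  apply aux_mem_eRad
  · have := aux_basic k hA e hee x
    rwa [hx] at this
  · rw [← mul_assoc, hx]

lemma aux_Se_simple (k : Type*) [Field k] {A : Type*} [Ring A] [Algebra k A]
    [FiniteDimensional k A] (hA : IsBasicRing A) (e : A) (he : IsPrimitiveIdempotent e) :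
    IsSimpleModule Aᵐᵒᵖ (SeModule A e) := by
  have hee : e * e = e := he.1
  have hnt : Nontrivial (SeModule A e) := by
    refine ⟨⟨Submodule.Quotient.mk ⟨e, (aux_mem_rightIdeal _ _ hee).mpr hee⟩, 0, ?_⟩⟩
    intro h
    have h' := (Submodule.Quotient.mk_eq_zero _).mp h
    rw [Submodule.mem_comap] at h'
    exact he.2.1 (aux_rad_eq_zero e (aux_eRad_le e e h') 1 e (by
      show e * (e * 1) = e
      rw [mul_one, hee]))
  rw [isSimpleModule_iff_toSpanSingleton_surjective]
  refine ⟨hnt, ?_⟩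
  intro s hs t
  have hes : MulOpposite.op e • s = s := by
    have := aux_Se_smul k hA e he s
    rw [MulOpposite.op_sub, sub_smul, MulOpposite.op_one, one_smul, sub_eq_zero] at this
    exact this.symm
  obtain ⟨⟨x, hx⟩, rfl⟩ := Submodule.Quotient.mk_surjective _ s
  obtain ⟨⟨z, hz⟩, rfl⟩ := Submodule.Quotient.mk_surjective _ t
  have hx' := (aux_mem_rightIdeal _ _ hee).mp hx
  have hz' := (aux_mem_rightIdeal _ _ hee).mp hz
  rcases aux_nil_or_unit k e he (x * e) (by rw [← mul_assoc, hx']) (by rw [mul_assoc, hee])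
    with h | ⟨y, hy1, hy2, hy3, hy4⟩
  · exfalso
    apply hs
    rw [← hes]
    refine (Submodule.Quotient.mk_eq_zero _).mpr ?_
    rw [Submodule.mem_comap]
    exact aux_mem_eRad e _ (aux_corner_nil_mem k e he (x * e) (by rw [← mul_assoc, hx'])
      (by rw [mul_assoc, hee]) h) (by
        show e * (x * e) = x * e
        rw [← mul_assoc, hx'])
  · refine ⟨MulOpposite.op (e * y * z), ?_⟩
    refine (LinearMap.toSpanSingleton_apply _ _ _ _).trans ?_
    refine congrArg (Submodule.Quotient.mk (p := (eRad A e).comap (rightIdeal A e).subtype))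
      (Subtype.ext ?_)
    show x * (e * y * z) = z
    rw [← mul_assoc, ← mul_assoc, hy3, hz']

lemma aux_simple_equiv (k : Type*) [Field k] {A : Type*} [Ring A] [Algebra k A]
    [FiniteDimensional k A] (hA : IsBasicRing A) (e : A) (he : IsPrimitiveIdempotent e)
    (L : Type*) [AddCommGroup L] [Module Aᵐᵒᵖ L] [IsSimpleModule Aᵐᵒᵖ L]
    (hL : ∀ x : L, MulOpposite.op (1 - e) • x = 0) :
    Nonempty (SeModule A e ≃ₗ[Aᵐᵒᵖ] L) := by
  have hee : e * e = e := he.1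
  have hS := aux_Se_simple k hA e he
  have hnt := IsSimpleModule.nontrivial Aᵐᵒᵖ L
  obtain ⟨x, hx⟩ := exists_ne (0 : L)
  have hex : MulOpposite.op e • x = x := by
    have := hL x
    rw [MulOpposite.op_sub, sub_smul, MulOpposite.op_one, one_smul, sub_eq_zero] at this
    exact this.symm
  have hJ : ∀ j ∈ ringRadical A, MulOpposite.op j • x = 0 := by
    intro j hj
    by_contra h
    obtain ⟨a, ha⟩ := IsSimpleModule.toSpanSingleton_surjective Aᵐᵒᵖ h x
    rw [LinearMap.toSpanSingleton_apply, smul_smul] at ha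
    exact hx (aux_rad_eq_zero j hj a.unop x ha)
  let φ : A →ₗ[Aᵐᵒᵖ] L :=
    { toFun := fun a => MulOpposite.op a • x
      map_add' := fun a b => by rw [MulOpposite.op_add, add_smul]
      map_smul' := fun r a => by
        show MulOpposite.op (a * r.unop) • x = _
        rw [MulOpposite.op_mul, mul_smul]; rfl }
  let ψ : SeModule A e →ₗ[Aᵐᵒᵖ] L := Submodule.liftQ _ (φ.comp (rightIdeal A e).subtype) (by
    intro y hy
    exact hJ _ (aux_eRad_le e _ hy))
  have hψ : ψ ≠ 0 := by
    intro h
    have := LinearMap.congr_fun h (Submodule.Quotient.mk ⟨e, (aux_mem_rightIdeal _ _ hee).mpr hee⟩)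
    apply hx
    rw [← hex]
    exact this
  exact ⟨LinearEquiv.ofBijective ψ (LinearMap.bijective_of_ne_zero hψ)⟩

/-- Vanishing of `Ext^j(M, S)`. -/
def AuxV {R : Type} [Ring R] [HasExt.{w} (ModuleCat.{0} R)] (S : ModuleCat.{0} R)
    (M : Type) [AddCommGroup M] [Module R M] (j : ℕ) : Prop :=
  Subsingleton (Ext (ModuleCat.of R M) S j)

section AuxHom
variable {R : Type} [Ring R] [HasExt.{w} (ModuleCat.{0} R)] {S : ModuleCat.{0} R}
  {X Y Z : Type} [AddCommGroup X] [Module R X] [AddCommGroup Y] [Module R Y]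
  [AddCommGroup Z] [Module R Z]

lemma aux_ses {R : Type} [Ring R] {X Y Z : Type} [AddCommGroup X] [Module R X]
    [AddCommGroup Y] [Module R Y] [AddCommGroup Z] [Module R Z] (f : X →ₗ[R] Y) (g : Y →ₗ[R] Z) (h : Function.Exact f g)
    (hf : Function.Injective f) (hg : Function.Surjective g) :
    (ModuleCat.shortComplexOfCompEqZero f g h.linearMap_comp_eq_zero).ShortExact :=
  ModuleCat.shortComplex_shortExact _ h hf hg

lemma aux_V_mid (f : X →ₗ[R] Y) (g : Y →ₗ[R] Z) (h : Function.Exact f g)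
    (hf : Function.Injective f) (hg : Function.Surjective g) {j : ℕ}
    (h1 : AuxV S X j) (h3 : AuxV S Z j) : AuxV S Y j := by
  unfold AuxV at *
  refine subsingleton_of_forall_eq 0 fun x => ?_
  obtain ⟨y, hy⟩ := Ext.contravariant_sequence_exact₂ (aux_ses f g h hf hg) S x
    (h1.elim _ _)
  rw [← hy, h3.elim y 0, Ext.comp_zero]

lemma aux_V_left (f : X →ₗ[R] Y) (g : Y →ₗ[R] Z) (h : Function.Exact f g)
    (hf : Function.Injective f) (hg : Function.Surjective g) {j : ℕ}
    (h2 : AuxV S Y j) (h3 : AuxV S Z (j + 1)) : AuxV S X j := by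
  unfold AuxV at *
  refine subsingleton_of_forall_eq 0 fun x => ?_
  obtain ⟨y, hy⟩ := Ext.contravariant_sequence_exact₁ (aux_ses f g h hf hg) S x
    (add_comm 1 j) (h3.elim _ _)
  rw [← hy, h2.elim y 0, Ext.comp_zero]

lemma aux_V_right (f : X →ₗ[R] Y) (g : Y →ₗ[R] Z) (h : Function.Exact f g)
    (hf : Function.Injective f) (hg : Function.Surjective g) {j : ℕ}
    (h2 : AuxV S Y (j + 1)) (h1 : AuxV S X j) : AuxV S Z (j + 1) := by
  unfold AuxV at *
  refine subsingleton_of_forall_eq 0 fun x => ?_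
  obtain ⟨y, hy⟩ := Ext.contravariant_sequence_exact₃ (aux_ses f g h hf hg) S x
    (h2.elim _ _) (add_comm 1 j)
  rw [← hy, h1.elim y 0, Ext.comp_zero]

lemma aux_V_zero_iff : AuxV S X 0 ↔ ∀ g : X →ₗ[R] S, g = 0 := by
  unfold AuxV
  constructor
  · intro h g
    have := (Ext.homEquiv₀ (X := ModuleCat.of R X) (Y := S)).symm.subsingleton.elim
      (ModuleCat.ofHom g) 0
    exact congrArg ModuleCat.Hom.hom this
  · intro h
    have : Subsingleton (ModuleCat.of R X ⟶ S) :=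
      subsingleton_of_forall_eq 0 fun x => ModuleCat.hom_ext (h x.hom)
    exact (Ext.homEquiv₀ (X := ModuleCat.of R X) (Y := S)).subsingleton

lemma aux_V_proj [Module.Projective R X] (j : ℕ) (hj : 0 < j) : AuxV S X j := by
  have : Projective (ModuleCat.of R X) := (IsProjective.iff_projective X).mp inferInstance
  exact HasProjectiveDimensionLT.subsingleton (ModuleCat.of R X) 1 j hj S

lemma aux_V_triv [Subsingleton X] (j : ℕ) : AuxV S X j := by
  have : HasProjectiveDimensionLT (ModuleCat.of R X) 0 :=
    (ModuleCat.isZero_of_subsingleton (ModuleCat.of R X)).hasProjectiveDimensionLT_zero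
  exact HasProjectiveDimensionLT.subsingleton (ModuleCat.of R X) 0 j (Nat.zero_le _) S

lemma aux_H1 (φ : R) (n : ℕ)
    (hsimp : ∀ (L : Type) [AddCommGroup L] [Module R L] [IsSimpleModule R L],
      (∀ x : L, φ • x = 0) → Nonempty (S ≃ₗ[R] L))
    (hn : ∀ j, n < j → AuxV S S j) (j : ℕ) (hj : n < j) (H : Type) [AddCommGroup H] [Module R H]
    (hH : IsFiniteLength R H) (hφ : ∀ x : H, φ • x = 0) : AuxV S H j := by
  induction hH with
  | of_subsingleton => exact aux_V_triv j
  | @of_simple_quotient M _ _ N _ _ ih =>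
    obtain ⟨ε⟩ := hsimp (M ⧸ N) (by
      intro x
      obtain ⟨y, rfl⟩ := Submodule.Quotient.mk_surjective _ x
      rw [← Submodule.Quotient.mk_smul, hφ, Submodule.Quotient.mk_zero])
    refine aux_V_mid N.subtype (ε.symm.toLinearMap ∘ₗ N.mkQ) ?_ N.injective_subtype
      (ε.symm.surjective.comp N.mkQ_surjective) (ih ?_) (hn j hj)
    · intro x
      simp
    · intro x
      exact Subtype.ext (hφ x.1)

lemma aux_H2 [IsArtinianRing R] (φ : R) (n : ℕ)
    (hsimp : ∀ (L : Type) [AddCommGroup L] [Module R L] [IsSimpleModule R L],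
      (∀ x : L, φ • x = 0) → Nonempty (S ≃ₗ[R] L))
    (hn : ∀ j, n < j → AuxV S S j) (hnn : ¬ AuxV S S n) (H : Type) [AddCommGroup H] [Module R H]
    (hH : IsFiniteLength R H) (hφ : ∀ x : H, φ • x = 0) (hV : AuxV S H n) : Subsingleton H := by
  by_contra hns
  rw [not_subsingleton_iff_nontrivial] at hns
  obtain ⟨_, hart⟩ := isFiniteLength_iff_isNoetherian_isArtinian.mp hH
  obtain ⟨L, hL⟩ := IsAtomic.exists_atom (Submodule R H)
  have hLs := isSimpleModule_iff_isAtom.mpr hL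
  obtain ⟨ε⟩ := hsimp L (fun x => Subtype.ext (hφ x.1))
  apply hnn
  refine aux_V_left (L.subtype ∘ₗ ε.toLinearMap) L.mkQ ?_
    (L.injective_subtype.comp ε.injective) L.mkQ_surjective hV
    (aux_H1 φ n hsimp hn _ (Nat.lt_succ_self n) (H ⧸ L)
      (hH.of_surjective L.mkQ_surjective) ?_)
  · intro x
    simp only [Submodule.mkQ_apply, Submodule.Quotient.mk_eq_zero, Set.mem_range]
    constructor
    · intro hx
      exact ⟨ε.symm ⟨x, hx⟩, by simp⟩
    · rintro ⟨y, rfl⟩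
      exact (ε y).2
  · intro x
    obtain ⟨y, rfl⟩ := Submodule.Quotient.mk_surjective _ x
    rw [← Submodule.Quotient.mk_smul, hφ, Submodule.Quotient.mk_zero]

lemma aux_step [IsNoetherianRing R] [IsArtinianRing R] (φ : R) (n : ℕ) (hn0 : 0 < n)
    (hS : ∀ s : S, φ • s = 0)
    (hsimp : ∀ (L : Type) [AddCommGroup L] [Module R L] [IsSimpleModule R L],
      (∀ x : L, φ • x = 0) → Nonempty (S ≃ₗ[R] L))
    (hn : ∀ j, n < j → AuxV S S j) (hnn : ¬ AuxV S S n)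
    (M P : Type) [AddCommGroup M] [Module R M] [AddCommGroup P] [Module R P] [Module.Finite R M]
    [Module.Projective R P] (hP : Submodule.span R {x : P | φ • x = x} = ⊤)
    (π : P →ₗ[R] M) (hπ : ∀ x : M, φ • x ∈ LinearMap.range π)
    (hK : (∀ j, n ≤ j → AuxV S (LinearMap.ker π.rangeRestrict) j) →
      ∀ j, AuxV S (LinearMap.ker π.rangeRestrict) j)
    (hM : ∀ j, n ≤ j → AuxV S M j) : ∀ j, AuxV S M j := by
  have hPV : ∀ j, AuxV S P j := by
    intro j
    rcases Nat.eq_zero_or_pos j with rfl | hj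
    · rw [aux_V_zero_iff]
      intro g
      apply LinearMap.ext_on hP
      intro x hx
      have hx' : φ • x = x := hx
      rw [← hx', map_smul, hS, map_smul, LinearMap.zero_apply, smul_zero]
    · exact aux_V_proj j hj
  have hfl : IsFiniteLength R (M ⧸ LinearMap.range π) :=
    isFiniteLength_iff_isNoetherian_isArtinian.mpr ⟨inferInstance, inferInstance⟩
  have hφH : ∀ x : M ⧸ LinearMap.range π, φ • x = 0 := by
    intro x
    obtain ⟨y, rfl⟩ := Submodule.Quotient.mk_surjective _ x
    rw [← Submodule.Quotient.mk_smul, Submodule.Quotient.mk_eq_zero]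
    exact hπ y
  have ex1 : Function.Exact (LinearMap.range π).subtype (LinearMap.range π).mkQ := by
    intro x; simp
  have ex2 : Function.Exact (LinearMap.ker π.rangeRestrict).subtype π.rangeRestrict :=
    LinearMap.exact_subtype_ker_map _
  have i1 := (LinearMap.range π).injective_subtype
  have s1 := (LinearMap.range π).mkQ_surjective
  have i2 := (LinearMap.ker π.rangeRestrict).injective_subtype
  have s2 := π.surjective_rangeRestrict
  have hKV := hK (by
    intro j hj
    refine aux_V_left _ _ ex2 i2 s2 (hPV j) ?_
    refine aux_V_left _ _ ex1 i1 s1 (hM (j + 1) (by omega)) ?_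
    exact aux_H1 φ n hsimp hn _ (by omega) _ hfl hφH)
  have hIV : ∀ j, AuxV S (LinearMap.range π) j := by
    intro j
    cases j with
    | zero =>
      rw [aux_V_zero_iff]
      intro g
      have := aux_V_zero_iff.mp (hPV 0) (g ∘ₗ π.rangeRestrict)
      ext y
      obtain ⟨x, rfl⟩ := s2 y
      exact LinearMap.congr_fun this x
    | succ j => exact aux_V_right _ _ ex2 i2 s2 (hPV _) (hKV j)
  have hH : Subsingleton (M ⧸ LinearMap.range π) := by
    refine aux_H2 φ n hsimp hn hnn _ hfl hφH ?_
    obtain ⟨m, rfl⟩ : ∃ m, n = m + 1 := ⟨n - 1, by omega⟩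
    exact aux_V_right _ _ ex1 i1 s1 (hM _ le_rfl) (hIV m)
  intro j
  exact aux_V_mid _ _ ex1 i1 s1 (hIV j) (aux_V_triv j)

end AuxHom

section AuxCorner
variable {A : Type} [Ring A]

/-- The part `M f` of a right module `M`. -/
def AuxFp (f : A) (M : Type) [AddCommGroup M] [Module Aᵐᵒᵖ M] : AddSubgroup M where
  carrier := {x | MulOpposite.op f • x = x}
  add_mem' := by
    intro a b ha hb
    show MulOpposite.op f • (a + b) = a + b
    rw [smul_add, show MulOpposite.op f • a = a from ha, show MulOpposite.op f • b = b from hb]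
  zero_mem' := smul_zero _
  neg_mem' := by
    intro a ha
    show MulOpposite.op f • (-a) = -a
    rw [smul_neg, show MulOpposite.op f • a = a from ha]

variable {f : A} (hf : IsIdempotentElem f)
  {M : Type} [AddCommGroup M] [Module Aᵐᵒᵖ M] {N : Type} [AddCommGroup N] [Module Aᵐᵒᵖ N]

lemma aux_Fp_val (x : AuxFp f M) : MulOpposite.op f • x.1 = x.1 := x.2

lemma aux_Fp_smul_mem (g : CornerRing f hf) (x : M) :
    MulOpposite.op g.1 • x ∈ AuxFp f M := by
  show MulOpposite.op f • (MulOpposite.op g.1 • x) = _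
  rw [smul_smul, ← MulOpposite.op_mul, g.2.2]

instance auxFpModule : Module (CornerRing f hf)ᵐᵒᵖ (AuxFp f M) where
  smul g x := ⟨MulOpposite.op g.unop.1 • x.1, aux_Fp_smul_mem hf _ _⟩
  one_smul x := Subtype.ext x.2
  mul_smul g h x := Subtype.ext (mul_smul (MulOpposite.op g.unop.1) (MulOpposite.op h.unop.1) x.1)
  smul_zero g := Subtype.ext (smul_zero (MulOpposite.op g.unop.1))
  smul_add g x y := Subtype.ext (smul_add (MulOpposite.op g.unop.1) x.1 y.1)
  add_smul g h x := Subtype.ext (add_smul (MulOpposite.op g.unop.1) (MulOpposite.op h.unop.1) x.1)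
  zero_smul x := Subtype.ext (zero_smul Aᵐᵒᵖ x.1)

/-- Functoriality of `M f`. -/
def auxFpMap (g : M →ₗ[Aᵐᵒᵖ] N) : AuxFp f M →ₗ[(CornerRing f hf)ᵐᵒᵖ] AuxFp f N where
  toFun x := ⟨g x.1, by
    show MulOpposite.op f • g x.1 = g x.1
    rw [← map_smul, aux_Fp_val]⟩
  map_add' x y := Subtype.ext (map_add g x.1 y.1)
  map_smul' r x := Subtype.ext (map_smul g (MulOpposite.op r.unop.1) x.1)

lemma aux_proj_op (B : Type) [Ring B] (r : ℕ) : Module.Projective Bᵐᵒᵖ (Fin r → B) := by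
  have e : Bᵐᵒᵖ ≃ₗ[Bᵐᵒᵖ] B :=
    { toFun := fun x => x.unop
      invFun := fun x => MulOpposite.op x
      left_inv := fun _ => rfl
      right_inv := fun _ => rfl
      map_add' := fun _ _ => rfl
      map_smul' := fun _ _ => rfl }
  have : Module.Free Bᵐᵒᵖ B := Module.Free.of_equiv e
  infer_instance

/-- Left multiplication by a family of columns. -/
def auxQ {r : ℕ} (w : Fin r → M) : (Fin r → A) →ₗ[Aᵐᵒᵖ] M where
  toFun v := ∑ i, MulOpposite.op (v i) • w i
  map_add' x y := by
    simp only [Pi.add_apply, MulOpposite.op_add, add_smul, Finset.sum_add_distrib]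
  map_smul' a x := by
    simp only [Pi.smul_apply, RingHom.id_apply, Finset.smul_sum, smul_smul]
    rfl

lemma auxQ_apply {r : ℕ} (w : Fin r → M) (v : Fin r → A) :
    auxQ w v = ∑ i, MulOpposite.op (v i) • w i := rfl

lemma auxQ_naturality {r : ℕ} (w : Fin r → M) (g : M →ₗ[Aᵐᵒᵖ] N) (v : Fin r → A) :
    g (auxQ w v) = auxQ (fun i => g (w i)) v := by
  simp [auxQ_apply]

/-- generators of `M f` -/
lemma aux_gens [IsNoetherianRing Aᵐᵒᵖ] [Module.Finite Aᵐᵒᵖ M] :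
    ∃ (r : ℕ) (x : Fin r → M), (∀ i, MulOpposite.op f • x i = x i) ∧
      ∀ y : M, MulOpposite.op f • y = y → y ∈ LinearMap.range (auxQ (A := A) x) := by
  have hfg : (Submodule.span Aᵐᵒᵖ (AuxFp f M : Set M)).FG := IsNoetherian.noetherian _
  obtain ⟨s, hs, hspan⟩ := (Submodule.fg_span_iff_fg_span_finset_subset _).mp hfg
  let ε := s.equivFin
  refine ⟨s.card, fun i => (ε.symm i).1, fun i => hs (ε.symm i).2, ?_⟩
  intro y hy
  have h1 : y ∈ Submodule.span Aᵐᵒᵖ (AuxFp f M : Set M) := Submodule.subset_span hy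
  rw [hspan] at h1
  refine Submodule.span_le.mpr ?_ h1
  intro z hz
  refine ⟨Pi.single (ε ⟨z, hz⟩) 1, ?_⟩
  rw [auxQ_apply, Finset.sum_eq_single (ε ⟨z, hz⟩)]
  · simp
  · intro j _ hj
    rw [Pi.single_eq_of_ne hj]; simp
  · simp

section AuxP
variable {r : ℕ} (x : Fin r → M) (w : Fin r → (Fin r → A))

lemma aux_P_proj (hw : ∀ i, auxQ w (w i) = w i) :
    Module.Projective Aᵐᵒᵖ (LinearMap.range (auxQ (A := A) w)) := by
  have := aux_proj_op A r
  refine Module.Projective.of_split (LinearMap.range (auxQ (A := A) w)).subtype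
    (auxQ (A := A) w).rangeRestrict ?_
  apply LinearMap.ext
  rintro ⟨_, v, rfl⟩
  apply Subtype.ext
  show auxQ w (auxQ w v) = auxQ w v
  rw [auxQ_naturality]
  simp only [hw]

lemma aux_P_span (hwf : ∀ i, MulOpposite.op f • w i = w i) (hw : ∀ i, auxQ w (w i) = w i) :
    Submodule.span Aᵐᵒᵖ {y : LinearMap.range (auxQ (A := A) w) | MulOpposite.op f • y = y} = ⊤ := by
  rw [eq_top_iff]
  rintro ⟨_, v, rfl⟩ _
  have : (⟨auxQ w v, ⟨v, rfl⟩⟩ : LinearMap.range (auxQ (A := A) w)) =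
      ∑ i, MulOpposite.op (v i) • (⟨w i, ⟨w i, hw i⟩⟩ : LinearMap.range (auxQ (A := A) w)) := by
    apply Subtype.ext
    simp [auxQ_apply]
  rw [this]
  refine Submodule.sum_mem _ fun i _ => Submodule.smul_mem _ _ (Submodule.subset_span ?_)
  exact Subtype.ext (hwf i)

/-- the map `P → M` -/
def auxPi : LinearMap.range (auxQ (A := A) w) →ₗ[Aᵐᵒᵖ] M :=
  (auxQ (A := A) x).comp (LinearMap.range (auxQ (A := A) w)).subtype

lemma aux_Pi_range (hw : ∀ i, auxQ w (w i) = w i) (hx : ∀ i, auxQ x (w i) = x i) (y : M)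
    (hy : y ∈ LinearMap.range (auxQ (A := A) x)) : y ∈ LinearMap.range (auxPi x w) := by
  obtain ⟨v, rfl⟩ := hy
  refine ⟨⟨auxQ w v, ⟨v, rfl⟩⟩, ?_⟩
  show auxQ x (auxQ w v) = _
  rw [auxQ_naturality]
  simp only [hx]

end AuxP

lemma aux_free_w {r : ℕ} (x : Fin r → M) (hx : ∀ i, MulOpposite.op f • x i = x i) (i : Fin r) :
    auxQ x (Pi.single i f) = x i := by
  rw [auxQ_apply, Finset.sum_eq_single i]
  · simp [hx]
  · intro j _ hj
    rw [Pi.single_eq_of_ne hj]; simp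
  · simp

lemma aux_single_f (hf : IsIdempotentElem f) {r : ℕ} (i : Fin r) :
    MulOpposite.op f • (Pi.single i f : Fin r → A) = Pi.single i f := by
  rw [← Pi.single_smul]
  congr 1

lemma aux_free_apply {r : ℕ} (v : Fin r → A) (j : Fin r) :
    auxQ (M := Fin r → A) (fun i => Pi.single i f) v j = f * v j := by
  rw [auxQ_apply, Finset.sum_apply, Finset.sum_eq_single j]
  · simp
  · intro i _ hi
    rw [Pi.smul_apply, Pi.single_eq_of_ne hi.symm]; simp
  · simp

lemma aux_free_mem (hf : IsIdempotentElem f) {r : ℕ} (v : Fin r → A) :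
    v ∈ LinearMap.range (auxQ (A := A) (M := Fin r → A) (fun i => Pi.single i f)) ↔
      ∀ j, f * v j = v j := by
  constructor
  · rintro ⟨u, rfl⟩ j
    rw [aux_free_apply, ← mul_assoc, hf.eq]
  · intro h
    exact ⟨v, funext fun j => by rw [aux_free_apply, h]⟩

lemma aux_free_proj {r : ℕ} : Module.Projective (CornerRing f hf)ᵐᵒᵖ
    (AuxFp f (LinearMap.range (auxQ (A := A) (M := Fin r → A) (fun i => Pi.single i f)))) := by
  have := aux_proj_op (CornerRing f hf) r
  have key : ∀ (v : AuxFp f (LinearMap.range (auxQ (A := A) (M := Fin r → A)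
      (fun i => Pi.single i f)))) (j : Fin r), f * v.1.1 j = v.1.1 j ∧ v.1.1 j * f = v.1.1 j := by
    intro v j
    refine ⟨(aux_free_mem hf v.1.1).mp v.1.2 j, ?_⟩
    exact congrFun (congrArg Subtype.val (aux_Fp_val v)) j
  let ε : (Fin r → CornerRing f hf) ≃ₗ[(CornerRing f hf)ᵐᵒᵖ]
      (AuxFp f (LinearMap.range (auxQ (A := A) (M := Fin r → A) (fun i => Pi.single i f)))) :=
    { toFun := fun v => ⟨⟨fun j => (v j).1, (aux_free_mem hf _).mpr fun j => (v j).2.1⟩,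
        Subtype.ext (funext fun j => (v j).2.2)⟩
      invFun := fun v j => ⟨v.1.1 j, key v j⟩
      left_inv := fun _ => rfl
      right_inv := fun _ => rfl
      map_add' := fun _ _ => rfl
      map_smul' := fun _ _ => rfl }
  exact Module.Projective.of_equiv ε

end AuxCorner

lemma aux_main_induction {A : Type} [Ring A] [IsNoetherianRing Aᵐᵒᵖ] [IsArtinianRing Aᵐᵒᵖ]
    [HasExt.{w} (ModuleCat.{0} Aᵐᵒᵖ)] {S : ModuleCat.{0} Aᵐᵒᵖ}
    {f : A} (hf : IsIdempotentElem f) (n : ℕ) (hn0 : 0 < n)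
    (hS : ∀ s : S, MulOpposite.op f • s = 0)
    (hsimp : ∀ (L : Type) [AddCommGroup L] [Module Aᵐᵒᵖ L] [IsSimpleModule Aᵐᵒᵖ L],
      (∀ x : L, MulOpposite.op f • x = 0) → Nonempty (S ≃ₗ[Aᵐᵒᵖ] L))
    (hn : ∀ j, n < j → AuxV S S j) (hnn : ¬ AuxV S S n) (d : ℕ) :
    ∀ (M : Type) [AddCommGroup M] [Module Aᵐᵒᵖ M] [Module.Finite Aᵐᵒᵖ M],
      HasProjectiveDimensionLT (ModuleCat.of (CornerRing f hf)ᵐᵒᵖ (AuxFp f M)) d →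
      (∀ j, n ≤ j → AuxV S M j) → ∀ j, AuxV S M j := by
  have hff : ∀ {M : Type} [AddCommGroup M] [Module Aᵐᵒᵖ M] (y : M),
      MulOpposite.op f • (MulOpposite.op f • y) = MulOpposite.op f • y := by
    intro M _ _ y
    rw [smul_smul, ← MulOpposite.op_mul, hf.eq]
  have hzero : ∀ (M : Type) [AddCommGroup M] [Module Aᵐᵒᵖ M] [Module.Finite Aᵐᵒᵖ M],
      (∀ y : M, MulOpposite.op f • y = y → y = 0) →
      (∀ j, n ≤ j → AuxV S M j) → ∀ j, AuxV S M j := by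
    intro M _ _ _ h0 hV j
    have : Subsingleton M := aux_H2 (MulOpposite.op f) n hsimp hn hnn M
      (isFiniteLength_iff_isNoetherian_isArtinian.mpr ⟨inferInstance, inferInstance⟩)
      (fun y => h0 _ (hff y)) (hV n le_rfl)
    exact aux_V_triv j
  induction d with
  | zero =>
    intro M _ _ _ hpd
    apply hzero M
    have h0 : Subsingleton (AuxFp f M) :=
      ModuleCat.subsingleton_of_isZero
        (isZero_of_hasProjectiveDimensionLT_zero (ModuleCat.of (CornerRing f hf)ᵐᵒᵖ (AuxFp f M)))
    intro y hy
    exact congrArg Subtype.val (h0.elim ⟨y, hy⟩ 0)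
  | succ d ih =>
    intro M _ _ _ hpd
    obtain ⟨r, x, hx, hgen⟩ := aux_gens (A := A) (f := f) (M := M)
    have hρ : ∀ y : AuxFp f M, ∃ v : Fin r → CornerRing f hf,
        auxQ x (fun i => (v i).1) = y.1 := by
      intro y
      obtain ⟨v, hv⟩ := hgen y.1 (aux_Fp_val y)
      refine ⟨fun i => ⟨f * v i * f, by rw [← mul_assoc, ← mul_assoc, hf.eq],
        by rw [mul_assoc, hf.eq]⟩, ?_⟩
      rw [← aux_Fp_val y, ← hv, auxQ_apply, auxQ_apply, Finset.smul_sum]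
      refine Finset.sum_congr rfl fun i _ => ?_
      rw [MulOpposite.op_mul, MulOpposite.op_mul, mul_smul, mul_smul, hx]
    rcases Nat.eq_zero_or_pos d with rfl | hd
    · -- `M f` is projective
      have hproj : Projective (ModuleCat.of (CornerRing f hf)ᵐᵒᵖ (AuxFp f M)) :=
        projective_iff_hasProjectiveDimensionLT_one.mpr hpd
      have hproj' : Module.Projective (CornerRing f hf)ᵐᵒᵖ (AuxFp f M) :=
        (IsProjective.iff_projective _).mpr hproj
      let ρ : (Fin r → CornerRing f hf) →ₗ[(CornerRing f hf)ᵐᵒᵖ] AuxFp f M :=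
        auxQ (A := CornerRing f hf) (fun i => (⟨x i, hx i⟩ : AuxFp f M))
      have hρval : ∀ v, (ρ v).1 = auxQ x (fun i => (v i).1) := by
        intro v
        rw [auxQ_apply]
        exact map_sum (AuxFp f M).subtype
          (fun i => MulOpposite.op (v i) • (⟨x i, hx i⟩ : AuxFp f M)) Finset.univ
      have hρs : Function.Surjective ρ := by
        intro y
        obtain ⟨v, hv⟩ := hρ y
        exact ⟨v, Subtype.ext ((hρval v).trans hv)⟩
      obtain ⟨s, hs⟩ := Module.projective_lifting_property ρ LinearMap.id hρs
      have hs' : ∀ y, ρ (s y) = y := fun y => LinearMap.congr_fun hs y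
      let w : Fin r → (Fin r → A) := fun i j => (s ⟨x i, hx i⟩ j).1
      have hwf : ∀ i, MulOpposite.op f • w i = w i := fun i =>
        funext fun j => (s ⟨x i, hx i⟩ j).2.2
      -- `w` computes `s ∘ ρ`
      have hwv : ∀ v : Fin r → CornerRing f hf,
          auxQ w (fun i => (v i).1) = fun j => (s (ρ v) j).1 := by
        intro v
        have h1 : s (ρ v) = ∑ i, MulOpposite.op (v i) • s ⟨x i, hx i⟩ := by
          show s (auxQ _ v) = _
          rw [auxQ_naturality, auxQ_apply]
        rw [h1, auxQ_apply]
        funext j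
        rw [Finset.sum_apply, Finset.sum_apply]
        let ι : CornerRing f hf →+ A :=
          { toFun := fun a => a.1, map_zero' := rfl, map_add' := fun _ _ => rfl }
        exact (map_sum ι (fun c => (MulOpposite.op (v c) • s ⟨x c, hx c⟩) j) Finset.univ).symm
      have hw : ∀ i, auxQ w (w i) = w i := by
        intro i
        refine (hwv (s ⟨x i, hx i⟩)).trans ?_
        rw [hs']
      have hxw : ∀ i, auxQ x (w i) = x i := by
        intro i
        rw [← hρval (s ⟨x i, hx i⟩), hs']
      have := aux_P_proj w hw
      refine aux_step (MulOpposite.op f) n hn0 hS hsimp hn hnn M _ (aux_P_span w hwf hw)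
        (auxPi x w) (fun y => aux_Pi_range x w hw hxw _ (hgen _ (hff y))) ?_
      have hfin : Module.Finite Aᵐᵒᵖ (LinearMap.range (auxQ (A := A) w)) := by
        have : Module.Finite Aᵐᵒᵖ (⊤ : Submodule Aᵐᵒᵖ A) := by
          refine ⟨⟨{⟨1, trivial⟩}, ?_⟩⟩
          rw [eq_top_iff]
          rintro ⟨a, _⟩ _
          rw [Finset.coe_singleton, Submodule.mem_span_singleton]
          exact ⟨MulOpposite.op a, Subtype.ext (one_mul a)⟩
        have : Module.Finite Aᵐᵒᵖ A := Module.Finite.equiv Submodule.topEquiv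
        infer_instance
      apply hzero
      rintro ⟨⟨v, u, hu⟩, hv0⟩ hv
      have hvf : ∀ j, v j * f = v j := fun j =>
        congrFun (congrArg (fun z => z.1.1) hv) j
      have hfv : ∀ j, f * v j = v j := by
        intro j
        rw [← hu, auxQ_apply, Finset.sum_apply, Finset.mul_sum]
        refine Finset.sum_congr rfl fun i _ => ?_
        show f * ((s ⟨x i, hx i⟩ j).1 * u i) = (s ⟨x i, hx i⟩ j).1 * u i
        rw [← mul_assoc, (s ⟨x i, hx i⟩ j).2.1]
      let v' : Fin r → CornerRing f hf := fun j => ⟨v j, hfv j, hvf j⟩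
      have hQ : auxQ w v = v := by
        rw [← hu, auxQ_naturality]
        simp only [hw]
      have hπ0 : auxQ x v = 0 := congrArg Subtype.val hv0
      have hρ0 : ρ v' = 0 := Subtype.ext ((hρval v').trans hπ0)
      have hv00 : v = 0 := by
        have h2 := hwv v'
        rw [hρ0, map_zero] at h2
        exact hQ.symm.trans h2
      exact Subtype.ext (Subtype.ext hv00)
    · -- free cover
      obtain ⟨d, rfl⟩ : ∃ d', d = d' + 1 := ⟨d - 1, by omega⟩
      let w : Fin r → (Fin r → A) := fun i => Pi.single i f
      have hwf : ∀ i, MulOpposite.op f • w i = w i := fun i => aux_single_f hf i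
      have hw : ∀ i, auxQ w (w i) = w i := fun i => aux_free_w w hwf i
      have hxw : ∀ i, auxQ x (w i) = x i := fun i => aux_free_w x hx i
      have := aux_P_proj w hw
      refine aux_step (MulOpposite.op f) n hn0 hS hsimp hn hnn M _ (aux_P_span w hwf hw)
        (auxPi x w) (fun y => aux_Pi_range x w hw hxw _ (hgen _ (hff y))) ?_
      have hfin : Module.Finite Aᵐᵒᵖ (LinearMap.range (auxQ (A := A) w)) := by
        have : Module.Finite Aᵐᵒᵖ (⊤ : Submodule Aᵐᵒᵖ A) := by
          refine ⟨⟨{⟨1, trivial⟩}, ?_⟩⟩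
          rw [eq_top_iff]
          rintro ⟨a, _⟩ _
          rw [Finset.coe_singleton, Submodule.mem_span_singleton]
          exact ⟨MulOpposite.op a, Subtype.ext (one_mul a)⟩
        have : Module.Finite Aᵐᵒᵖ A := Module.Finite.equiv Submodule.topEquiv
        infer_instance
      apply ih
      let K := LinearMap.ker (auxPi x w).rangeRestrict
      let i : AuxFp f K →ₗ[(CornerRing f hf)ᵐᵒᵖ] AuxFp f (LinearMap.range (auxQ (A := A) w)) :=
        auxFpMap hf K.subtype
      let p : AuxFp f (LinearMap.range (auxQ (A := A) w)) →ₗ[(CornerRing f hf)ᵐᵒᵖ] AuxFp f M :=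
        auxFpMap hf (auxPi x w)
      have h_ex : Function.Exact i p := by
        intro y
        constructor
        · intro hy
          refine ⟨⟨⟨y.1, ?_⟩, ?_⟩, rfl⟩
          · have h6 : (p y).1 = 0 := congrArg Subtype.val hy
            exact Subtype.ext h6
          · exact Subtype.ext y.2
        · rintro ⟨z, rfl⟩
          have h7 : (auxPi x w).rangeRestrict z.1.1 = 0 := z.1.2
          have h8 : auxPi x w z.1.1 = 0 := congrArg Subtype.val h7
          exact Subtype.ext h8
      have h_inj : Function.Injective i := by
        intro y z hyz
        have h3 : (i y).1 = (i z).1 := congrArg Subtype.val hyz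
        have h4 : y.1.1 = z.1.1 := h3
        exact Subtype.ext (Subtype.ext h4)
      have h_surj : Function.Surjective p := by
        intro y
        obtain ⟨u, hu'⟩ := aux_Pi_range x w hw hxw y.1 (hgen _ y.2)
        have h5 : MulOpposite.op f • (MulOpposite.op f • u) = MulOpposite.op f • u := hff u
        refine ⟨⟨MulOpposite.op f • u, h5⟩, Subtype.ext ?_⟩
        show auxPi x w (MulOpposite.op f • u) = y.1
        rw [map_smul, hu', aux_Fp_val]
      have hex := aux_ses i p h_ex h_inj h_surj
      have hprojP := aux_free_proj (r := r) hf
      have : Projective (ModuleCat.of (CornerRing f hf)ᵐᵒᵖ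
          (AuxFp f (LinearMap.range (auxQ (A := A) w)))) :=
        (IsProjective.iff_projective _).mp hprojP
      exact (hex.hasProjectiveDimensionLT_X₃_iff d this).mp hpd

lemma aux_rightIdeal_proj {A : Type} [Ring A] (e : A) (he : e * e = e) :
    Module.Projective Aᵐᵒᵖ (rightIdeal A e) := by
  let ε : Aᵐᵒᵖ ≃ₗ[Aᵐᵒᵖ] A :=
    { toFun := fun x => x.unop
      invFun := fun x => MulOpposite.op x
      left_inv := fun _ => rfl
      right_inv := fun _ => rfl
      map_add' := fun _ _ => rfl
      map_smul' := fun _ _ => rfl }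
  have : Module.Projective Aᵐᵒᵖ A := Module.Projective.of_equiv ε
  let p : A →ₗ[Aᵐᵒᵖ] rightIdeal A e :=
    { toFun := fun a => ⟨e * a, (aux_mem_rightIdeal e _ he).mpr (by rw [← mul_assoc, he])⟩
      map_add' := fun a b => Subtype.ext (mul_add e a b)
      map_smul' := fun a b => Subtype.ext (mul_assoc e b a.unop).symm }
  refine Module.Projective.of_split (rightIdeal A e).subtype p ?_
  ext x
  exact (aux_mem_rightIdeal e _ he).mp x.2

/-- **Corollary.** Let `A` be a basic finite dimensional algebra over an algebraically closed
field `k` and let `e` be a primitive idempotent of `A` such that `Γ = (1-e)A(1-e)` has finite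
global dimension. Then either `Ext^i_A(S_e, S_e)` is non-zero for infinitely many `i`, or
`Ext^i_A(S_e, S_e) = 0` for all `i > 0`. -/
theorem ext_infinite_or_vanishing_of_corner_finite_global_dimension
    (k : Type) [Field k] [IsAlgClosed k]
    (A : Type) [Ring A] [Algebra k A] [FiniteDimensional k A]
    (hbasic : IsBasicRing A)
    (e : A) (he : IsPrimitiveIdempotent e)
    (hGamma : HasFiniteGlobalDimension (CornerRing (1 - e) he.1.one_sub)) :
    {i : ℕ | Nontrivial (CategoryTheory.Abelian.Ext (Se A e) (Se A e) i)}.Infinite ∨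
      ∀ i : ℕ, 0 < i → Subsingleton (CategoryTheory.Abelian.Ext (Se A e) (Se A e) i) := by
  have : Module.Finite k Aᵐᵒᵖ := Module.Finite.equiv (MulOpposite.opLinearEquiv k : A ≃ₗ[k] Aᵐᵒᵖ)
  have : IsNoetherianRing Aᵐᵒᵖ := IsNoetherianRing.of_finite k Aᵐᵒᵖ
  have : IsArtinianRing Aᵐᵒᵖ := IsArtinianRing.of_finite k Aᵐᵒᵖ
  have hA : FiniteDimensional k A := inferInstance
  by_contra hcon
  rw [not_or, Set.not_infinite] at hcon
  obtain ⟨hfin, hex⟩ := hcon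
  push Not at hex
  obtain ⟨m, hm0, hm⟩ := hex
  obtain ⟨n, hnmem, hnmax⟩ := Set.exists_max_image _ id hfin ⟨m, hm⟩
  have hmn : m ≤ n := hnmax m hm
  have hn : ∀ j, n < j → AuxV (Se A e) (Se A e) j := by
    intro j hj
    show Subsingleton (Ext (Se A e) (Se A e) j)
    rw [← not_nontrivial_iff_subsingleton]
    intro h
    have : j ≤ n := hnmax j h
    omega
  have hnn : ¬ AuxV (Se A e) (Se A e) n := by
    show ¬ Subsingleton (Ext (Se A e) (Se A e) n)
    rw [not_subsingleton_iff_nontrivial]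
    exact hnmem
  obtain ⟨d, hd⟩ := hGamma
  have hpd : ∀ M : ModuleCat.{0} (CornerRing (1 - e) he.1.one_sub)ᵐᵒᵖ,
      HasProjectiveDimensionLT M (d + 1) := by
    intro M
    rw [hasProjectiveDimensionLT_iff]
    intro i hi Y x
    exact (hd M Y i (by omega)).elim _ _
  have hP := aux_rightIdeal_proj e he.1
  have hFin : Module.Finite Aᵐᵒᵖ (rightIdeal A e) := by
    unfold rightIdeal
    infer_instance
  have key := aux_main_induction (S := Se A e) he.1.one_sub n (by omega)
    (fun s => aux_Se_smul k hbasic e he s)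
    (fun L _ _ _ hL => aux_simple_equiv k hbasic e he L hL) hn hnn (d + 1) (rightIdeal A e)
    (hpd _) (fun j hj => aux_V_proj j (by omega)) 0
  rw [aux_V_zero_iff] at key
  have hq : ((eRad A e).comap (rightIdeal A e).subtype).mkQ = 0 := key _
  have hsub : Subsingleton (SeModule A e) := by
    refine subsingleton_of_forall_eq 0 fun s => ?_
    obtain ⟨y, rfl⟩ := Submodule.mkQ_surjective _ s
    exact LinearMap.congr_fun hq y
  have : Subsingleton (Se A e) := hsub
  exact hnn (aux_V_triv n)
end

section
/- If A has finite global dimension, then 𝒮_e is covariantly finite in the bounded derived category D(A): for every object M of D(A) there exists a morphism f: M → S with S ∈ 𝒮_e such that Hom_{D(A)}(f, S') is surjective for every S' ∈ 𝒮_e. -/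
set_option linter.unusedVariables false
set_option maxHeartbeats 1000000

/-! Common setup: corner rings, the simple module `S_e`, Ext-algebras (Yoneda rings),
semiperfect and basic rings, finite global dimension. -/

open CategoryTheory CategoryTheory.Abelian
open scoped DirectSum

/-! ### The bounded derived category `D(A)` and the subcategory `𝒮_e` -/

noncomputable instance (R : Type) [Ring R] : HasDerivedCategory (ModuleCat.{0} R) :=
  HasDerivedCategory.standard _

section Derived

open CategoryTheory Limits

variable (A : Type) [Ring A]

/-- A right `A`-module belongs to `add S_e` if it is a direct summand of a finite
direct sum of copies of `S_e`. -/
def MemAddSe (e : A) (M : ModuleCat Aᵐᵒᵖ) : Prop :=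
  ∃ (m : ℕ) (s : M ⟶ ModuleCat.of Aᵐᵒᵖ (Fin m → SeModule A e))
    (r : ModuleCat.of Aᵐᵒᵖ (Fin m → SeModule A e) ⟶ M), s ≫ r = 𝟙 M

/-- An object of the derived category of `Mod A` belongs to the bounded derived category
`D(A) = D^b(mod A)` if its cohomologies are finitely generated and almost all vanish. -/
def MemDb (X : DerivedCategory (ModuleCat Aᵐᵒᵖ)) : Prop :=
  (∀ n : ℤ, Module.Finite Aᵐᵒᵖ ((DerivedCategory.homologyFunctor (ModuleCat Aᵐᵒᵖ) n).obj X)) ∧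
    ∃ N : ℕ, ∀ n : ℤ, (N : ℤ) < |n| →
      IsZero ((DerivedCategory.homologyFunctor (ModuleCat Aᵐᵒᵖ) n).obj X)

/-- An object of the derived category lies in `𝒮_e` (the additive closure of all shifts of
objects of `add S_e`) iff it is isomorphic to a bounded complex with zero differentials
all of whose terms lie in `add S_e`. -/
def MemSe (e : A) (X : DerivedCategory (ModuleCat Aᵐᵒᵖ)) : Prop :=
  ∃ K : CochainComplex (ModuleCat Aᵐᵒᵖ) ℤ,
    (∀ i j, K.d i j = 0) ∧
    (∃ N : ℕ, ∀ i : ℤ, (N : ℤ) < |i| → IsZero (K.X i)) ∧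
    (∀ i, MemAddSe A e (K.X i)) ∧
    Nonempty (X ≅ DerivedCategory.Q.obj K)

/-- `f : X ⟶ S` is a left `𝒮_e`-approximation if `S ∈ 𝒮_e` and every morphism from `X`
to an object of `𝒮_e` factors through `f`. -/
def IsLeftSeApprox (e : A) {X S : DerivedCategory (ModuleCat Aᵐᵒᵖ)} (f : X ⟶ S) : Prop :=
  MemSe A e S ∧
    ∀ (S' : DerivedCategory (ModuleCat Aᵐᵒᵖ)), MemSe A e S' →
      ∀ h : X ⟶ S', ∃ g : S ⟶ S', f ≫ g = h

/-- A left `𝒮_e`-approximation is minimal if every endomorphism compatible with it is an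
isomorphism. -/
def IsMinimalLeftSeApprox (e : A) {X S : DerivedCategory (ModuleCat Aᵐᵒᵖ)} (f : X ⟶ S) :
    Prop :=
  IsLeftSeApprox A e f ∧ ∀ h : S ⟶ S, f ≫ h = f → IsIso h

end Derived

theorem noeth_end_of_artinian {R S Q : Type*} [Ring R] [AddCommGroup S] [Module R S]
    [AddCommGroup Q] [Module R Q] [IsSemisimpleModule R S] [IsArtinian R Q]
    (φ : S → (Q →ₗ[R] S)) (q0 : Q) (hφ : ∀ s, φ s q0 = s) :
    IsNoetherian (Module.End R S) S := by
  classical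
  constructor
  intro W
  let T : Set (Submodule R Q) :=
    {K | ∃ F : Finset S, (F : Set S) ⊆ W ∧ K = ⨅ s ∈ F, LinearMap.ker (φ s)}
  obtain ⟨K, ⟨F, hF, rfl⟩, hmin⟩ := WellFounded.has_min
    (wellFounded_lt (α := Submodule R Q)) T ⟨_, ∅, by simp, rfl⟩
  refine ⟨F, le_antisymm (Submodule.span_le.2 hF) ?_⟩
  intro w hw
  have hle : (⨅ s ∈ F, LinearMap.ker (φ s)) ≤ LinearMap.ker (φ w) := by
    have h1 : (⨅ s ∈ insert w F, LinearMap.ker (φ s)) ∈ T := by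
      refine ⟨insert w F, ?_, rfl⟩
      intro x hx
      rcases Finset.mem_insert.1 (Finset.mem_coe.1 hx) with rfl | hx
      · exact hw
      · exact hF hx
    have h2 := hmin _ h1
    rw [Finset.iInf_insert] at h2
    by_contra h3
    exact h2 (inf_lt_right.2 h3)
  let Φ : Q →ₗ[R] (F → S) := LinearMap.pi (fun s => φ s)
  have hker : LinearMap.ker Φ ≤ LinearMap.ker (φ w) := by
    refine le_trans ?_ hle
    intro q hq
    simp only [Submodule.mem_iInf, LinearMap.mem_ker] at hq ⊢
    intro s hs
    exact congrFun hq ⟨s, hs⟩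
  -- extend
  let f1 : (Q ⧸ LinearMap.ker Φ) →ₗ[R] (F → S) := (LinearMap.ker Φ).liftQ Φ le_rfl
  have hf1 : Function.Injective f1 := LinearMap.ker_eq_bot.1 (Submodule.ker_liftQ_eq_bot _ _ _ le_rfl)
  obtain ⟨ψ, hψ⟩ := IsSemisimpleModule.extension_property f1 hf1
    ((LinearMap.ker Φ).liftQ (φ w) hker)
  have h4 : w = ψ (fun s => (s : S)) := by
    have := LinearMap.congr_fun hψ (Submodule.Quotient.mk q0)
    simp only [LinearMap.comp_apply, f1, Submodule.liftQ_apply] at this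
    rw [hφ] at this
    rw [← this]
    congr 1
    funext s
    simp [Φ, hφ]
  have h5 : (fun s : F => (s : S)) = ∑ i : F, Pi.single i (i : S) :=
    (Finset.univ_sum_single _).symm
  rw [h4, h5, map_sum]
  refine Submodule.sum_mem _ fun i _ => ?_
  exact Submodule.smul_mem _ ((ψ ∘ₗ LinearMap.single R (fun _ : F => S) i) : Module.End R S)
    (Submodule.subset_span i.2)

section corner
variable {A : Type*} [Ring A]

theorem unit_one_sub_of_corner {f u v : A} (hf : f * f = f) (hu : f * u = u)
    (hv1 : f * v = v) (hv2 : v * f = v) (h1 : (f - u * f) * v = f) (h2 : v * (f - u * f) = f) :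
    (1 - u) * (v + (1 - f) + v * u * (1 - f)) = 1 ∧
    (v + (1 - f) + v * u * (1 - f)) * (1 - u) = 1 := by
  have h1' : u * v = v - f := by rw [sub_mul, hv1, mul_assoc, hv1] at h1; rw [← h1]; abel
  have h2' : v * u * f = v - f := by
    rw [mul_sub, hv2, ← mul_assoc] at h2; nth_rw 2 [← h2]; abel
  have h3 : u * v * u = v * u - u := by rw [h1', sub_mul, hu]
  have h4 : v * u * f * u = v * u - u := by rw [h2', sub_mul, hu]
  constructor
  · have : (1 - u) * (v + (1 - f) + v * u * (1 - f)) =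
      v - u * v + (1 - f) - u + u * f + (v * u - u * v * u) - (v * u - u * v * u) * f := by
      noncomm_ring
    rw [this, h3, h1']
    noncomm_ring
  · have : (v + (1 - f) + v * u * (1 - f)) * (1 - u) =
      v + 1 - f - u + f * u - v * u * f + (v * u * f * u - v * u * u) := by
      noncomm_ring
    have h5 : v * u * f * u = v * u * u := by rw [mul_assoc _ f, hu]
    rw [this, h5, hu, h2']
    noncomm_ring

theorem corner_key {f : A} (hf : IsIdempotentElem f) [IsLocalRing (CornerRing f hf)]
    {x : A} (hx : f * x = x) (hJ : x ∉ ringRadical A) : ∃ y, x * y = f := by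
  by_contra! hcon
  apply hJ
  change x ∈ (⊥ : TwoSidedIdeal A).jacobson
  rw [TwoSidedIdeal.mem_jacobson_iff]
  intro y
  have hu : f * (-(x * y)) = -(x * y) := by rw [mul_neg, ← mul_assoc, hx]
  generalize hudef : -(x * y) = u at hu
  let a : CornerRing f hf := ⟨u * f, by rw [← mul_assoc, hu], by rw [mul_assoc, hf]⟩
  have ha : a + (1 - a) = 1 := by abel
  rcases IsLocalRing.isUnit_or_isUnit_of_add_one ha with h | h
  · exfalso
    obtain ⟨⟨a', v, h1, h2⟩, rfl⟩ := h
    have h1 : u * f * v.1 = f := congrArg Subtype.val h1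
    apply hcon (-(y * f * v.1))
    refine Eq.trans ?_ h1
    rw [← hudef]
    generalize v.1 = v'
    noncomm_ring
  · obtain ⟨⟨a', v, h1, h2⟩, h3⟩ := h
    simp only at h3
    subst h3
    have h1 : (f + -(u * f)) * v.1 = f := congrArg Subtype.val h1
    have h2 : v.1 * (f + -(u * f)) = f := congrArg Subtype.val h2
    rw [← sub_eq_add_neg] at h1 h2
    obtain ⟨-, hw⟩ := unit_one_sub_of_corner hf hu v.2.1 v.2.2 h1 h2
    generalize (v.1 + (1 - f) + v.1 * u * (1 - f)) = w at hw
    refine ⟨1 - y * w * x, ?_⟩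
    have : (1 - y * w * x) * y * x + (1 - y * w * x) - 1
      = y * x - y * (w * (1 - -(x * y))) * x := by noncomm_ring
    rw [this, hudef, hw]
    simp

theorem not_mem_radical {f : A} (hf : IsIdempotentElem f) [IsLocalRing (CornerRing f hf)] :
    f ∉ ringRadical A := by
  intro h
  change f ∈ (⊥ : TwoSidedIdeal A).jacobson at h
  rw [TwoSidedIdeal.mem_jacobson_iff] at h
  obtain ⟨z, hz⟩ := h (-1)
  have hz : z * (-1) * f + z - 1 = 0 := hz
  have h0 : f = 0 := by
    have h1 : (z * (-1) * f + z - 1) * f = z * f - z * (f * f) - f := by noncomm_ring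
    rw [hz, hf.eq] at h1
    simpa using h1
  apply one_ne_zero (α := CornerRing f hf)
  exact Subtype.ext h0

/-- The radical as a right submodule. -/
def radSub (A : Type*) [Ring A] : Submodule Aᵐᵒᵖ A where
  carrier := ringRadical A
  add_mem' := fun {a b} ha hb => (⊥ : TwoSidedIdeal A).jacobson.add_mem ha hb
  zero_mem' := (⊥ : TwoSidedIdeal A).jacobson.zero_mem
  smul_mem' := fun c x hx => (⊥ : TwoSidedIdeal A).jacobson.mul_mem_right x c.unop hx

theorem top_semisimple (hA : IsSemiperfectRing A) :
    IsSemisimpleModule Aᵐᵒᵖ (A ⧸ radSub A) := by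
  obtain ⟨n, f, hf, -, hsum, hloc⟩ := hA
  let p : Fin n → Submodule Aᵐᵒᵖ (A ⧸ radSub A) :=
    fun i => Submodule.span Aᵐᵒᵖ {(radSub A).mkQ (f i)}
  have hp : ∀ i, IsSemisimpleModule Aᵐᵒᵖ (p i) := by
    intro i
    have := hloc i
    have hs : IsSimpleModule Aᵐᵒᵖ (p i) := by
      rw [isSimpleModule_iff_toSpanSingleton_surjective]
      constructor
      · refine ⟨⟨⟨_, Submodule.mem_span_singleton_self _⟩, 0, ?_⟩⟩
        intro h
        have h : (radSub A).mkQ (f i) = 0 := congrArg Subtype.val h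
        rw [Submodule.mkQ_apply, Submodule.Quotient.mk_eq_zero] at h
        exact not_mem_radical (hf i) h
      · rintro ⟨m, hm⟩ hm0 ⟨m', hm'⟩
        obtain ⟨a, rfl⟩ := Submodule.mem_span_singleton.1 hm
        obtain ⟨b, rfl⟩ := Submodule.mem_span_singleton.1 hm'
        have h1 : f i * a.unop ∉ ringRadical A := by
          intro h
          apply hm0
          apply Subtype.ext
          change a • (radSub A).mkQ (f i) = 0
          rw [← map_smul, Submodule.mkQ_apply, Submodule.Quotient.mk_eq_zero]
          exact h
        obtain ⟨y, hy⟩ := corner_key (hf i) (by rw [← mul_assoc, (hf i).eq]) h1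
        refine ⟨b * MulOpposite.op y, ?_⟩
        apply Subtype.ext
        change (b * MulOpposite.op y) • a • (radSub A).mkQ (f i) = b • (radSub A).mkQ (f i)
        rw [mul_smul]
        congr 1
        rw [← map_smul, ← map_smul]
        congr 1
    infer_instance
  refine isSemisimpleModule_of_isSemisimpleModule_submodule' hp ?_
  rw [eq_top_iff]
  rintro x -
  obtain ⟨a, rfl⟩ := (radSub A).mkQ_surjective x
  have h1 : a = ∑ i, MulOpposite.op a • f i := by
    rw [← Finset.smul_sum, hsum]; simp
  rw [h1, map_sum]
  refine Submodule.sum_mem _ fun i _ => ?_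
  rw [map_smul]
  exact Submodule.smul_mem _ _ (Submodule.mem_iSup_of_mem i (Submodule.mem_span_singleton_self _))

theorem top_artinian (hA : IsSemiperfectRing A) :
    IsArtinian Aᵐᵒᵖ (A ⧸ radSub A) := by
  have := top_semisimple hA
  have h1 : Module.Finite Aᵐᵒᵖ A := by
    refine ⟨⟨{1}, ?_⟩⟩
    rw [eq_top_iff, Finset.coe_singleton]
    rintro x -
    exact Submodule.mem_span_singleton.2 ⟨MulOpposite.op x, by simp⟩
  have h2 : Module.Finite Aᵐᵒᵖ (A ⧸ radSub A) := Module.Finite.quotient Aᵐᵒᵖ (radSub A)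
  have h3 := IsSemisimpleModule.finite_tfae (R := Aᵐᵒᵖ) (M := A ⧸ radSub A)
  exact (h3.out 0 2).1 h2

/-- The projection `eA → S_e`. -/
def seMk (A : Type*) [Ring A] (e : A) : rightIdeal A e →ₗ[Aᵐᵒᵖ] SeModule A e :=
  ((eRad A e).comap (rightIdeal A e).subtype).mkQ

theorem seMk_surjective (e : A) : Function.Surjective (seMk A e) :=
  Submodule.mkQ_surjective _

theorem seMk_eq_zero (e : A) (x : rightIdeal A e) (hx : x.1 ∈ eRad A e) : seMk A e x = 0 :=
  (Submodule.Quotient.mk_eq_zero _).2 hx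

theorem exists_map_to_Se (e : A) (s : SeModule A e) :
    ∃ φ : (A ⧸ radSub A) →ₗ[Aᵐᵒᵖ] SeModule A e,
      ∀ a : A, φ ((radSub A).mkQ a) = MulOpposite.op a • s := by
  let g : A →ₗ[Aᵐᵒᵖ] SeModule A e :=
    { toFun := fun a => MulOpposite.op a • s
      map_add' := fun a b => add_smul (MulOpposite.op a) (MulOpposite.op b) s
      map_smul' := fun r a => by
        change MulOpposite.op (a * r.unop) • s = r • MulOpposite.op a • s
        rw [← mul_smul]; rfl }
  refine ⟨(radSub A).liftQ g ?_, fun a => rfl⟩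
  intro j hj
  have hj : j ∈ ringRadical A := hj
  obtain ⟨⟨x, hx⟩, rfl⟩ := seMk_surjective e s
  obtain ⟨a, rfl⟩ := Submodule.mem_span_singleton.1 hx
  rw [LinearMap.mem_ker]
  change MulOpposite.op j • seMk A e _ = 0
  rw [← map_smul]
  apply seMk_eq_zero
  refine Submodule.subset_span ⟨a.unop * j, ?_, ?_⟩
  · exact (⊥ : TwoSidedIdeal A).jacobson.mul_mem_left _ _ hj
  · change e * (a.unop * j) = (e * a.unop) * j
    rw [mul_assoc]

theorem Se_noeth (hA : IsSemiperfectRing A) (e : A) :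
    IsNoetherian (Module.End Aᵐᵒᵖ (SeModule A e)) (SeModule A e) := by
  have := top_semisimple hA
  have := top_artinian hA
  choose φ hφ using exists_map_to_Se (A := A) e
  have : IsSemisimpleModule Aᵐᵒᵖ (SeModule A e) := by
    refine IsSemisimpleModule.of_surjective
      (φ (seMk A e ⟨e, Submodule.mem_span_singleton_self _⟩)) ?_
    intro s
    obtain ⟨⟨x, hx⟩, rfl⟩ := seMk_surjective e s
    obtain ⟨a, rfl⟩ := Submodule.mem_span_singleton.1 hx
    exact ⟨(radSub A).mkQ a.unop, hφ _ _⟩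
  exact noeth_end_of_artinian φ ((radSub A).mkQ 1) (fun s => by rw [hφ]; exact one_smul Aᵐᵒᵖ s)

end corner

section derivedPart
open CategoryTheory Limits Pretriangulated DerivedCategory

variable {R : Type} [Ring R]

theorem hom_single_subsingleton (X Y : ModuleCat.{0} R) (b j : ℤ) (n : ℕ) (h : b = j + n)
    [hE : Subsingleton (Ext X Y n)] (f : (singleFunctor (ModuleCat.{0} R) b).obj X ⟶
      (singleFunctor (ModuleCat.{0} R) j).obj Y) : f = 0 := by
  apply (shiftFunctor (DerivedCategory (ModuleCat.{0} R)) b).map_injective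
  rw [Functor.map_zero]
  let e₁ := ((singleFunctors (ModuleCat.{0} R)).shiftIso b 0 b (by lia)).app X
  let e₂ := ((singleFunctors (ModuleCat.{0} R)).shiftIso b (-n) j (by lia)).app Y
  let e₃ := ((singleFunctors (ModuleCat.{0} R)).shiftIso n (-n) 0 (by lia)).app Y
  have hsub : Subsingleton (ShiftedHom ((singleFunctor (ModuleCat.{0} R) 0).obj X)
    ((singleFunctor (ModuleCat.{0} R) 0).obj Y) (n : ℤ)) :=
    (Ext.homEquiv (X := X) (Y := Y) (n := n)).symm.injective.subsingleton
  have h1 : e₁.inv ≫ (shiftFunctor _ b).map f ≫ e₂.hom ≫ e₃.inv = 0 := hsub.elim _ _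
  have h2 : (shiftFunctor _ b).map f = e₁.hom ≫
    (e₁.inv ≫ (shiftFunctor _ b).map f ≫ e₂.hom ≫ e₃.inv) ≫ e₃.hom ≫ e₂.inv := by simp
  rw [h2, h1]
  simp

theorem hom_single_projective (P Y : ModuleCat.{0} R) [Projective P] (b j : ℤ) (h : b ≠ j)
    (f : (singleFunctor (ModuleCat.{0} R) b).obj P ⟶
      (singleFunctor (ModuleCat.{0} R) j).obj Y) : f = 0 := by
  rcases lt_or_gt_of_ne h with h | h
  · exact TStructure.t.zero f b j h
  · exact from_singleFunctor_obj_eq_zero_of_projective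
      (L := (CochainComplex.singleFunctor _ j).obj Y) f j h

theorem exists_cover (K : CochainComplex (ModuleCat.{0} R) ℤ) (b : ℤ)
    (P : ModuleCat.{0} R) [Projective P] (π : P ⟶ K.homology b) [Epi π] :
    ∃ φ : (CochainComplex.singleFunctor _ b).obj P ⟶ K,
      Epi (HomologicalComplex.homologyMap φ b) := by
  let l : P ⟶ K.cycles b := Projective.factorThru π (K.homologyπ b)
  let φ : (HomologicalComplex.single _ (ComplexShape.up ℤ) b).obj P ⟶ K :=
    HomologicalComplex.mkHomFromSingle (l ≫ K.iCycles b) (by simp)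
  refine ⟨φ, ?_⟩
  have h1 : (HomologicalComplex.singleObjCyclesSelfIso (ComplexShape.up ℤ) b P).inv ≫
      HomologicalComplex.cyclesMap φ b = l := by
    rw [← cancel_mono (K.iCycles b)]
    simp [φ]
  have h2 : (HomologicalComplex.singleObjHomologySelfIso (ComplexShape.up ℤ) b P).inv ≫
      HomologicalComplex.homologyMap φ b = π := by
    rw [← HomologicalComplex.singleObjCyclesSelfIso_inv_homologyπ, Category.assoc,
      HomologicalComplex.homologyπ_naturality, reassoc_of% h1]
    simp [l]
  exact epi_of_epi_fac h2

theorem finite_mid [IsNoetherianRing R] (S : ShortComplex (ModuleCat.{0} R)) (hS : S.Exact)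
    (h1 : Module.Finite R S.X₁) (h3 : Module.Finite R S.X₃) : Module.Finite R S.X₂ := by
  have : IsNoetherian R S.X₁ := isNoetherian_of_isNoetherianRing_of_finite R _
  have : IsNoetherian R S.X₃ := isNoetherian_of_isNoetherianRing_of_finite R _
  have := isNoetherian_of_range_eq_ker S.f.hom S.g.hom
    ((ShortComplex.moduleCat_exact_iff_range_eq_ker S).1 hS)
  infer_instance

theorem step [IsNoetherianRing R] (M : DerivedCategory (ModuleCat.{0} R)) (b : ℤ)
    (hb : M.IsLE b)
    (hfin : ∀ k, Module.Finite R ((homologyFunctor (ModuleCat.{0} R) k).obj M)) :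
    ∃ (n : ℕ) (M' : DerivedCategory (ModuleCat.{0} R))
      (u : (singleFunctor (ModuleCat.{0} R) b).obj (ModuleCat.of R (Fin n → R)) ⟶ M)
      (v : M ⟶ M') (w : M' ⟶ _), Triangle.mk u v w ∈ distTriang _ ∧ M'.IsLE (b - 1) ∧
      (∀ k, Module.Finite R ((homologyFunctor (ModuleCat.{0} R) k).obj M')) ∧
      ∀ a < b, M.IsGE a → M'.IsGE a := by
  obtain ⟨n, p, hp⟩ := Module.Finite.exists_fin' R ((homologyFunctor (ModuleCat.{0} R) b).obj M)
  let K := Q.objPreimage M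
  let e : Q.obj K ≅ M := Q.objObjPreimageIso M
  let P := ModuleCat.of R (Fin n → R)
  have hP : Projective P := inferInstance
  let q : P ⟶ (homologyFunctor (ModuleCat.{0} R) b).obj M := ModuleCat.ofHom p
  have hq : Epi q := (ModuleCat.epi_iff_surjective _).2 hp
  let i1 : (homologyFunctor (ModuleCat.{0} R) b).obj M ≅ K.homology b :=
    (homologyFunctor _ b).mapIso e.symm ≪≫ (homologyFunctorFactors _ b).app K
  have hq' : Epi (q ≫ i1.hom) := epi_comp _ _
  obtain ⟨φ, hφ⟩ := exists_cover K b P (q ≫ i1.hom)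
  let u : (singleFunctor (ModuleCat.{0} R) b).obj P ⟶ M := Q.map φ ≫ e.hom
  have hu : Epi ((homologyFunctor _ b).map u) := by
    have h1 : Epi ((homologyFunctor _ b).map (Q.map φ)) := by
      exact ((MorphismProperty.epimorphisms _).arrow_mk_iso_iff
        (((Functor.mapArrowFunctor _ _).mapIso
          (homologyFunctorFactors (ModuleCat.{0} R) b)).app (Arrow.mk φ))).2 hφ
    rw [show (homologyFunctor _ b).map u = (homologyFunctor _ b).map (Q.map φ) ≫
      (homologyFunctor _ b).map e.hom from Functor.map_comp _ _ _]
    exact @epi_comp _ _ _ _ _ _ h1 _ (IsIso.epi_of_iso _)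
  obtain ⟨M', v, w, hT⟩ := distinguished_cocone_triangle u
  have hz : ∀ k, k ≠ b → IsZero ((homologyFunctor (ModuleCat.{0} R) k).obj
      ((singleFunctor (ModuleCat.{0} R) b).obj P)) := by
    intro k hk
    rcases lt_or_gt_of_ne hk with h | h
    · exact isZero_of_isGE _ b k h
    · exact isZero_of_isLE _ b k h
  have hfinP : ∀ k, Module.Finite R ((homologyFunctor (ModuleCat.{0} R) k).obj
      ((singleFunctor (ModuleCat.{0} R) b).obj P)) := by
    intro k
    by_cases hk : k = b
    · subst hk
      have i := ((singleFunctorCompHomologyFunctorIso (ModuleCat.{0} R) k).app P).toLinearEquiv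
      exact Module.Finite.equiv (M := (Fin n → R)) i.symm
    · have := ModuleCat.subsingleton_of_isZero (hz k hk)
      infer_instance
  refine ⟨n, M', u, v, w, hT, ?_, ?_, ?_⟩
  · rw [isLE_iff]
    intro i hi
    refine (HomologySequence.exact₃ _ hT i (i+1) rfl).isZero_of_both_zeros ?_ ?_
    · by_cases hib : i = b
      · subst hib
        exact (HomologySequence.epi_homologyMap_mor₁_iff _ hT i).1 hu
      · exact (isZero_of_isLE M b i (by lia)).eq_of_src _ _
    · exact (hz (i+1) (by lia)).eq_of_tgt _ _
  · intro k
    exact finite_mid _ (HomologySequence.exact₃ _ hT k (k+1) rfl) (hfin k) (hfinP _)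
  · intro a ha hM
    rw [isGE_iff]
    intro i hi
    refine (HomologySequence.exact₃ _ hT i (i+1) rfl).isZero_of_both_zeros ?_ ?_
    · exact (isZero_of_isGE M a i (by lia)).eq_of_src _ _
    · exact (hz (i+1) (by lia)).eq_of_tgt _ _

/-- Precomposition as an `End T`-linear map. -/
def precompEnd {D : Type*} [Category D] [Preadditive D] {X Y : D} (u : X ⟶ Y) (T : D) :
    (Y ⟶ T) →ₗ[End T] (X ⟶ T) where
  toFun f := u ≫ f
  map_add' _ _ := Preadditive.comp_add _ _ _ _ _ _
  map_smul' _ _ := (Category.assoc _ _ _).symm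

theorem noeth_free (S : ModuleCat.{0} R)
    (hS : IsNoetherian (Module.End R S) S) (b : ℤ) (n : ℕ) :
    IsNoetherian (End ((singleFunctor (ModuleCat.{0} R) b).obj S))
      ((singleFunctor (ModuleCat.{0} R) b).obj (ModuleCat.of R (Fin n → R)) ⟶
        (singleFunctor (ModuleCat.{0} R) b).obj S) := by
  let F := singleFunctor (ModuleCat.{0} R) b
  let X := F.obj (ModuleCat.of R (Fin n → R))
  let T := F.obj S
  let σ : Module.End R S →+* End T :=
    { toFun := fun r => F.map (ModuleCat.ofHom r)
      map_one' := F.map_id S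
      map_mul' := fun r s => F.map_comp (ModuleCat.ofHom s) (ModuleCat.ofHom r)
      map_zero' := F.map_zero S S
      map_add' := fun r s => F.map_add (f := ModuleCat.ofHom r) (g := ModuleCat.ofHom s) }
  let m1 : Module (Module.End R S) (X ⟶ T) := Module.compHom (X ⟶ T) σ
  let m2 : SMul (Module.End R S) (End T) := ⟨fun r x => σ r * x⟩
  have m3 : IsScalarTower (Module.End R S) (End T) (X ⟶ T) :=
    ⟨fun r x m => mul_smul (σ r) x m⟩
  let L : (X ⟶ T) →ₗ[Module.End R S] (Fin n → S) :=
    { toFun := fun f i => (F.preimage f).hom (Pi.single i (1 : R))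
      map_add' := by
        intro f g
        have : F.preimage (f + g) = F.preimage f + F.preimage g :=
          F.map_injective (by simp)
        funext i
        rw [this]
        rfl
      map_smul' := by
        intro r f
        have : F.preimage (r • f) = F.preimage f ≫ ModuleCat.ofHom r := by
          apply F.map_injective
          rw [F.map_preimage, F.map_comp, F.map_preimage]
          rfl
        funext i
        rw [this]
        rfl }
  have hL : Function.Injective L := by
    intro f g h
    rw [← F.map_preimage f, ← F.map_preimage g]
    congr 1
    apply ModuleCat.hom_ext
    refine (Pi.basisFun R (Fin n)).ext fun i => ?_
    simpa [L] using congrFun h i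
  have : IsNoetherian (Module.End R S) (X ⟶ T) :=
    isNoetherian_of_injective L hL
  exact isNoetherian_of_tower (Module.End R S) this

theorem noeth_hom [IsNoetherianRing R] (S : ModuleCat.{0} R)
    (hS : IsNoetherian (Module.End R S) S) (j : ℤ) (d : ℕ) :
    ∀ (b : ℤ) (hb : b < j + d) (M : DerivedCategory (ModuleCat.{0} R)) (_ : M.IsLE b)
    (hfin : ∀ k, Module.Finite R ((homologyFunctor (ModuleCat.{0} R) k).obj M)),
    IsNoetherian (End ((singleFunctor (ModuleCat.{0} R) j).obj S))
      (M ⟶ (singleFunctor (ModuleCat.{0} R) j).obj S) := by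
  induction d with
  | zero =>
    intro b hb M hM hfin
    have : Subsingleton (M ⟶ (singleFunctor (ModuleCat.{0} R) j).obj S) :=
      subsingleton_of_forall_eq 0 fun f => TStructure.t.zero f b j (by simpa using hb)
    infer_instance
  | succ d ih =>
    intro b hb M hM hfin
    obtain ⟨n, M', u, v, w, hT, hLE, hfin', -⟩ := step M b hM hfin
    have := ih (b-1) (by push_cast at hb; lia) M' hLE hfin'
    let T := (singleFunctor (ModuleCat.{0} R) j).obj S
    have : IsNoetherian (End T)
      ((singleFunctor (ModuleCat.{0} R) b).obj (ModuleCat.of R (Fin n → R)) ⟶ T) := by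
      by_cases hbj : b = j
      · subst hbj
        exact noeth_free S hS b n
      · have : Subsingleton
          ((singleFunctor (ModuleCat.{0} R) b).obj (ModuleCat.of R (Fin n → R)) ⟶ T) :=
          subsingleton_of_forall_eq 0 fun f => hom_single_projective _ _ b j hbj f
        infer_instance
    refine isNoetherian_of_range_eq_ker (precompEnd v T) (precompEnd u T) ?_
    ext f
    constructor
    · rintro ⟨g, rfl⟩
      have h0 : u ≫ v = 0 := comp_distTriang_mor_zero₁₂ _ hT
      change u ≫ v ≫ g = 0
      rw [reassoc_of% h0, zero_comp]
    · intro hf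
      obtain ⟨g, hg⟩ := Triangle.yoneda_exact₂ _ hT f hf
      exact ⟨g, hg.symm⟩

theorem hom_vanish [IsNoetherianRing R] (N : ℕ) (S : ModuleCat.{0} R)
    (hN : ∀ (X : ModuleCat.{0} R) (i : ℕ), N < i → Subsingleton (Ext X S i))
    (a j : ℤ) (hj : j + N < a) (d : ℕ) :
    ∀ (M : DerivedCategory (ModuleCat.{0} R)) (_ : M.IsLE (a + d)) (_ : M.IsGE a)
    (hfin : ∀ k, Module.Finite R ((homologyFunctor (ModuleCat.{0} R) k).obj M))
    (f : M ⟶ (singleFunctor (ModuleCat.{0} R) j).obj S), f = 0 := by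
  induction d with
  | zero =>
    intro M hM hM' hfin f
    have : M.IsLE a := by simpa using hM
    obtain ⟨Y, ⟨e⟩⟩ := exists_iso_singleFunctor_obj_of_isGE_of_isLE M a
    rw [← cancel_epi e.inv, comp_zero]
    have := hN Y (a - j).toNat (by lia)
    exact hom_single_subsingleton Y S a j (a - j).toNat (by lia) _
  | succ d ih =>
    intro M hM hM' hfin f
    obtain ⟨n, M', u, v, w, hT, hLE, hfin', hGE⟩ := step M _ hM hfin
    have h0 : u ≫ f = 0 := hom_single_projective _ _ _ _ (by push_cast; lia) _
    obtain ⟨g, hg⟩ := Triangle.yoneda_exact₂ _ hT f h0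
    have : M'.IsLE (a + d) := by
      convert hLE using 1
      push_cast; ring
    have hg' : f = v ≫ (g : M' ⟶ (singleFunctor (ModuleCat.{0} R) j).obj S) := hg
    have hg0 : (g : M' ⟶ (singleFunctor (ModuleCat.{0} R) j).obj S) = 0 :=
      ih M' this (hGE a (by push_cast; lia) hM') hfin' g
    rw [hg', hg0]
    exact comp_zero

end derivedPart

section assembly
open CategoryTheory Limits DerivedCategory

theorem exists_fj {R : Type} [Ring R] (S : Type) [AddCommGroup S] [Module R S]
    (M : DerivedCategory (ModuleCat.{0} R)) (j : ℤ)
    (h : IsNoetherian (End ((singleFunctor (ModuleCat.{0} R) j).obj (ModuleCat.of R S)))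
      (M ⟶ (singleFunctor (ModuleCat.{0} R) j).obj (ModuleCat.of R S))) :
    ∃ (m : ℕ) (f : M ⟶ (singleFunctor (ModuleCat.{0} R) j).obj (ModuleCat.of R (Fin m → S))),
      (∀ y : M ⟶ (singleFunctor (ModuleCat.{0} R) j).obj (ModuleCat.of R S),
        ∃ g, f ≫ g = y) ∧
      ((∀ y : M ⟶ (singleFunctor (ModuleCat.{0} R) j).obj (ModuleCat.of R S), y = 0) →
        m = 0) := by
  let F := singleFunctor (ModuleCat.{0} R) j
  by_cases h0 : ∀ y : M ⟶ F.obj (ModuleCat.of R S), y = 0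
  · exact ⟨0, 0, fun y => ⟨0, by rw [h0 y]; exact comp_zero⟩, fun _ => rfl⟩
  · obtain ⟨m, x, hx⟩ := Submodule.fg_iff_exists_fin_generating_family.1 (h.noetherian ⊤)
    let π : ∀ i : Fin m, ModuleCat.of R (Fin m → S) ⟶ ModuleCat.of R S := fun i =>
      ModuleCat.ofHom (LinearMap.proj i)
    let ι : ∀ i : Fin m, ModuleCat.of R S ⟶ ModuleCat.of R (Fin m → S) := fun i =>
      ModuleCat.ofHom (LinearMap.single R (fun _ => S) i)
    have h1 : ∀ i, ι i ≫ π i = 𝟙 _ := by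
      intro i
      ext a
      simp [ι, π]
    have h2 : ∀ i k, i ≠ k → ι i ≫ π k = 0 := by
      intro i k hik
      ext a
      simp [ι, π, hik.symm]
    let f : M ⟶ F.obj (ModuleCat.of R (Fin m → S)) := ∑ i, (x i : M ⟶ F.obj (ModuleCat.of R S)) ≫ F.map (ι i)
    have hf : ∀ k, f ≫ F.map (π k) = x k := by
      intro k
      rw [Preadditive.sum_comp, Finset.sum_eq_single k]
      · rw [Category.assoc, ← F.map_comp, h1, F.map_id, Category.comp_id]
      · intro i _ hi
        rw [Category.assoc, ← F.map_comp, h2 _ _ hi, F.map_zero, comp_zero]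
      · simp
    refine ⟨m, f, fun y => ?_, fun hh => absurd hh h0⟩
    have hy : y ∈ Submodule.span (End (F.obj (ModuleCat.of R S))) (Set.range x) := by
      rw [hx]; trivial
    obtain ⟨c, hc⟩ := (Submodule.mem_span_range_iff_exists_fun _).1 hy
    refine ⟨∑ i, F.map (π i) ≫ (c i : F.obj (ModuleCat.of R S) ⟶ F.obj (ModuleCat.of R S)), ?_⟩
    rw [← hc, Preadditive.comp_sum]
    refine Finset.sum_congr rfl fun i _ => ?_
    rw [← Category.assoc, hf]
    rfl

theorem factor_add {R : Type} [Ring R] (S : Type) [AddCommGroup S] [Module R S]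
    (M T : DerivedCategory (ModuleCat.{0} R)) (j : ℤ) (f : M ⟶ T)
    (hf : ∀ y : M ⟶ (singleFunctor (ModuleCat.{0} R) j).obj (ModuleCat.of R S),
        ∃ g, f ≫ g = y)
    (X : ModuleCat.{0} R) (k : ℕ) (s : X ⟶ ModuleCat.of R (Fin k → S))
    (r : ModuleCat.of R (Fin k → S) ⟶ X) (hsr : s ≫ r = 𝟙 X)
    (y : M ⟶ (singleFunctor (ModuleCat.{0} R) j).obj X) : ∃ g, f ≫ g = y := by
  let F := singleFunctor (ModuleCat.{0} R) j
  let π : ∀ i : Fin k, ModuleCat.of R (Fin k → S) ⟶ ModuleCat.of R S := fun i =>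
    ModuleCat.ofHom (LinearMap.proj i)
  let ι : ∀ i : Fin k, ModuleCat.of R S ⟶ ModuleCat.of R (Fin k → S) := fun i =>
    ModuleCat.ofHom (LinearMap.single R (fun _ => S) i)
  have h1 : ∑ i, π i ≫ ι i = 𝟙 _ := by
    apply ModuleCat.hom_ext
    rw [ModuleCat.hom_sum]
    refine LinearMap.ext fun a => ?_
    rw [LinearMap.sum_apply]
    exact Finset.univ_sum_single a
  choose g hg using fun i => hf (y ≫ F.map s ≫ F.map (π i))
  refine ⟨∑ i, g i ≫ F.map (ι i) ≫ F.map r, ?_⟩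
  have h2 : y = y ≫ F.map (s ≫ (∑ i, π i ≫ ι i) ≫ r) := by
    rw [h1, Category.id_comp, hsr, F.map_id, Category.comp_id]
  conv_rhs => rw [h2]
  rw [Preadditive.comp_sum, Preadditive.sum_comp, Preadditive.comp_sum, Functor.map_sum,
    Preadditive.comp_sum]
  refine Finset.sum_congr rfl fun i _ => ?_
  rw [← Category.assoc, hg]
  simp only [Functor.map_comp, Category.assoc]

/-- The complex with zero differentials. -/
def zeroCx {C : Type*} [Category C] [HasZeroMorphisms C] (X : ℤ → C) : CochainComplex C ℤ where
  X := X
  d _ _ := 0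
  shape _ _ _ := rfl
  d_comp_d' _ _ _ _ _ := comp_zero

section cx
variable {C : Type*} [Category C] [Abelian C] (K : CochainComplex C ℤ)
  (hK : ∀ i j, K.d i j = 0)

/-- inclusion of a term -/
noncomputable def cxι (j : ℤ) : (CochainComplex.singleFunctor C j).obj (K.X j) ⟶ K :=
  HomologicalComplex.mkHomFromSingle (c := ComplexShape.up ℤ) (j := j) (𝟙 _) (fun i _ => by rw [hK, comp_zero])

/-- projection to a term -/
noncomputable def cxπ (j : ℤ) : K ⟶ (CochainComplex.singleFunctor C j).obj (K.X j) :=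
  HomologicalComplex.mkHomToSingle (c := ComplexShape.up ℤ) (j := j) (𝟙 _) (fun i _ => by rw [hK, zero_comp])

theorem cxι_π (j : ℤ) : cxι K hK j ≫ cxπ K hK j = 𝟙 _ := by
  apply HomologicalComplex.from_single_hom_ext (c := ComplexShape.up ℤ) (j := j)
  erw [HomologicalComplex.comp_f, HomologicalComplex.mkHomFromSingle_f, HomologicalComplex.mkHomToSingle_f]
  simp only [Category.id_comp, Category.comp_id]
  exact Iso.hom_inv_id _

theorem cxι_π_ne (i j : ℤ) (h : i ≠ j) : cxι K hK i ≫ cxπ K hK j = 0 := by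
  apply HomologicalComplex.from_single_hom_ext (c := ComplexShape.up ℤ) (j := i)
  exact (HomologicalComplex.isZero_single_obj_X (ComplexShape.up ℤ) j (K.X j) i h).eq_of_tgt _ _

theorem cx_sum (N : ℕ) (hN : ∀ i : ℤ, (N : ℤ) < |i| → IsZero (K.X i)) :
    ∑ j ∈ Finset.Icc (-N : ℤ) N, cxπ K hK j ≫ cxι K hK j = 𝟙 K := by
  ext i
  by_cases hi : (N : ℤ) < |i|
  · exact (hN i hi).eq_of_src _ _
  have hsum := map_sum (HomologicalComplex.Hom.fAddMonoidHom (C₁ := K) (C₂ := K) i)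
    (fun j => cxπ K hK j ≫ cxι K hK j) (Finset.Icc (-N : ℤ) N)
  refine hsum.trans ?_
  rw [Finset.sum_eq_single i]
  · change (cxπ K hK i).f i ≫ (cxι K hK i).f i = 𝟙 _
    erw [HomologicalComplex.mkHomFromSingle_f, HomologicalComplex.mkHomToSingle_f]
    simp only [Category.id_comp, Category.comp_id]
    exact Iso.inv_hom_id _
  · intro j _ hj
    change (cxπ K hK j).f i ≫ (cxι K hK j).f i = 0
    rw [(HomologicalComplex.isZero_single_obj_X (ComplexShape.up ℤ) j (K.X j) i hj.symm).eq_of_tgt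
      ((cxπ K hK j).f i) 0]
    exact zero_comp
  · intro h
    exfalso
    apply h
    rw [Finset.mem_Icc]
    exact abs_le.1 (not_lt.1 hi)

end cx

theorem main_thm
    (A : Type) [Ring A] (hNoeth : IsTwoSidedNoetherian A)
    (hsemi : IsSemiperfectRing A)
    (e : A) (hA : HasFiniteGlobalDimension A) :
    ∀ M : DerivedCategory (ModuleCat Aᵐᵒᵖ), MemDb A M →
      ∃ (S : DerivedCategory (ModuleCat Aᵐᵒᵖ)) (f : M ⟶ S),
        MemSe A e S ∧
          ∀ (S' : DerivedCategory (ModuleCat Aᵐᵒᵖ)), MemSe A e S' →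
            Function.Surjective (fun g : S ⟶ S' => f ≫ g) := by
  intro M ⟨hfin, N0, hN0⟩
  obtain ⟨n, hn⟩ := hA
  have := hNoeth.2
  have hLE : M.IsLE N0 := by
    rw [isLE_iff]
    intro i hi
    exact hN0 i (lt_of_lt_of_le hi (le_abs_self i))
  have hGE : M.IsGE (-N0) := by
    rw [isGE_iff]
    intro i hi
    exact hN0 i (by rw [lt_abs]; right; lia)
  let S := ModuleCat.of Aᵐᵒᵖ (SeModule A e)
  have hnoe : ∀ j, IsNoetherian (End ((singleFunctor (ModuleCat.{0} Aᵐᵒᵖ) j).obj S))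
      (M ⟶ (singleFunctor (ModuleCat.{0} Aᵐᵒᵖ) j).obj S) := fun j =>
    noeth_hom S (Se_noeth hsemi e) j ((N0 : ℤ) - j + 1).toNat N0 (by lia) M hLE hfin
  choose m f hf hm using fun j => exists_fj (SeModule A e) M j (hnoe j)
  let N := N0 + n
  have hm0 : ∀ j : ℤ, (N : ℤ) < |j| → m j = 0 := by
    intro j hj
    apply hm
    intro y
    rcases lt_abs.1 hj with h | h
    · exact TStructure.t.zero y (N0 : ℤ) j (by simp only [N] at h; push_cast at h; lia)
    · have : M.IsLE (-(N0 : ℤ) + ((2 * N0 : ℕ) : ℤ)) := by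
        convert hLE using 1
        push_cast; ring
      exact hom_vanish n S (fun X i hi => hn X S i hi) (-N0) j
        (by simp only [N] at h; push_cast at h; lia) (2 * N0) M this hGE hfin y
  let K : CochainComplex (ModuleCat.{0} Aᵐᵒᵖ) ℤ :=
    zeroCx (fun j => ModuleCat.of Aᵐᵒᵖ (Fin (m j) → SeModule A e))
  have hK : ∀ i j, K.d i j = 0 := fun _ _ => rfl
  have hKz : ∀ i : ℤ, (N : ℤ) < |i| → IsZero (K.X i) := by
    intro i hi
    have : IsEmpty (Fin (m i)) := by rw [hm0 i hi]; infer_instance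
    exact @ModuleCat.isZero_of_subsingleton _ _ (K.X i)
      (inferInstanceAs (Subsingleton (Fin (m i) → SeModule A e)))
  let F := fun j => singleFunctor (ModuleCat.{0} Aᵐᵒᵖ) j
  let f' : ∀ j, M ⟶ Q.obj ((CochainComplex.singleFunctor _ j).obj (K.X j)) := fun j => f j
  refine ⟨Q.obj K, ∑ j ∈ Finset.Icc (-N : ℤ) N, f' j ≫ Q.map (cxι K hK j),
    ⟨K, hK, ⟨N, hKz⟩, fun i => ⟨m i, 𝟙 _, 𝟙 _, Category.id_comp _⟩, ⟨Iso.refl _⟩⟩, ?_⟩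
  rintro S' ⟨K', hK', ⟨N', hN'⟩, hadd, ⟨φ⟩⟩ h
  have hg : ∀ j, ∃ g : Q.obj ((CochainComplex.singleFunctor _ j).obj (K.X j)) ⟶
      Q.obj ((CochainComplex.singleFunctor _ j).obj (K'.X j)),
      f' j ≫ g = h ≫ φ.hom ≫ Q.map (cxπ K' hK' j) := by
    intro j
    obtain ⟨k, s, r, hsr⟩ := hadd j
    exact factor_add (SeModule A e) M _ j (f j) (hf j) (K'.X j) k s r hsr
      (h ≫ φ.hom ≫ Q.map (cxπ K' hK' j))
  choose g hg using hg
  have hf0 : ∀ j : ℤ, (N : ℤ) < |j| → f' j = 0 := by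
    intro j hj
    have hz : IsZero ((CochainComplex.singleFunctor _ j).obj (K.X j)) :=
      Functor.map_isZero _ (hKz j hj)
    exact (Functor.map_isZero Q hz).eq_of_tgt _ _
  have hfπ : ∀ j, (∑ i ∈ Finset.Icc (-N : ℤ) N, f' i ≫ Q.map (cxι K hK i)) ≫
      Q.map (cxπ K hK j) = f' j := by
    intro j
    rw [Preadditive.sum_comp, Finset.sum_eq_single j]
    · rw [Category.assoc, ← Q.map_comp, cxι_π, Q.map_id, Category.comp_id]
    · intro i _ hi
      rw [Category.assoc, ← Q.map_comp, cxι_π_ne _ _ _ _ hi, Q.map_zero, comp_zero]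
    · intro hj
      rw [hf0 j, zero_comp, zero_comp]
      by_contra hc
      exact hj (Finset.mem_Icc.2 (abs_le.1 (not_lt.1 hc)))
  refine ⟨(∑ j ∈ Finset.Icc (-N' : ℤ) N', Q.map (cxπ K hK j) ≫ g j ≫ Q.map (cxι K' hK' j)) ≫ φ.inv, ?_⟩
  change (∑ i ∈ Finset.Icc (-N : ℤ) N, f' i ≫ Q.map (cxι K hK i)) ≫ _ = h
  rw [← Category.assoc, Iso.comp_inv_eq, Preadditive.comp_sum]
  have h2 : h ≫ φ.hom = (h ≫ φ.hom) ≫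
      Q.map (∑ j ∈ Finset.Icc (-N' : ℤ) N', cxπ K' hK' j ≫ cxι K' hK' j) := by
    rw [cx_sum K' hK' N' hN', Q.map_id, Category.comp_id]
  rw [h2, Functor.map_sum, Preadditive.comp_sum]
  refine Finset.sum_congr rfl fun j _ => ?_
  rw [← Category.assoc, hfπ, ← Category.assoc, hg, Q.map_comp]
  simp only [Category.assoc]

end assembly
open CategoryTheory in
/-- **Lemma.** If the Noetherian semiperfect basic ring `A` has finite global dimension,
then `𝒮_e` is covariantly finite in the bounded derived category `D(A)`: every bounded
complex `M` admits a left `𝒮_e`-approximation `f : M ⟶ S`. -/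
theorem Se_covariantly_finite
    (A : Type) [Ring A] (hNoeth : IsTwoSidedNoetherian A)
    (hsemi : IsSemiperfectRing A) (hbasic : IsBasicRing A)
    (e : A) (hA : HasFiniteGlobalDimension A) :
    ∀ M : DerivedCategory (ModuleCat Aᵐᵒᵖ), MemDb A M →
      ∃ (S : DerivedCategory (ModuleCat Aᵐᵒᵖ)) (f : M ⟶ S),
        MemSe A e S ∧
          ∀ (S' : DerivedCategory (ModuleCat Aᵐᵒᵖ)), MemSe A e S' →
            Function.Surjective (fun g : S ⟶ S' => f ≫ g) := by
  exact main_thm A hNoeth hsemi e hA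
end

section
/- Let C ∈ D(A) with a minimal left 𝒮_e-approximation C → S, and consider the induced exact triangle C[-1] →^u S[-1] →^v C' → C. Then the kernel of the natural transformation Hom_{D(A)}(u, −) restricted to 𝒮_e is isomorphic to the functor Hom_{D(A)}(C', −) restricted to 𝒮_e. -/
set_option linter.unusedVariables false
set_option maxHeartbeats 1000000

/-! Common setup: corner rings, the simple module `S_e`, Ext-algebras (Yoneda rings),
semiperfect and basic rings, finite global dimension. -/

open CategoryTheory CategoryTheory.Abelian
open scoped DirectSum

open CategoryTheory Pretriangulated in
/-- **Lemma.** Let `C ∈ D(A)` with a minimal left `𝒮_e`-approximation `f : C ⟶ S`, and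
consider the induced exact triangle `C[-1] →u S[-1] →v C' → C`. Then the kernel of
`Hom(u, −)` restricted to `𝒮_e` is isomorphic (via composition with `v`) to the functor
`Hom(C', −)` restricted to `𝒮_e`. -/
theorem kernel_hom_approximation_triangle
    (A : Type) [Ring A] (hNoeth : IsTwoSidedNoetherian A)
    (hsemi : IsSemiperfectRing A) (hbasic : IsBasicRing A) (e : A)
    (C S C' : DerivedCategory (ModuleCat Aᵐᵒᵖ)) (hC : MemDb A C)
    (f : C ⟶ S) (hf : IsMinimalLeftSeApprox A e f)
    (v : S⟦(-1 : ℤ)⟧ ⟶ C') (w : C' ⟶ C⟦(-1 : ℤ)⟧⟦(1 : ℤ)⟧)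
    (hT : Triangle.mk ((shiftFunctor (DerivedCategory (ModuleCat Aᵐᵒᵖ)) (-1 : ℤ)).map f) v w
      ∈ distTriang (DerivedCategory (ModuleCat Aᵐᵒᵖ))) :
    ∀ S'' : DerivedCategory (ModuleCat Aᵐᵒᵖ), MemSe A e S'' →
      Function.Injective (fun g : C' ⟶ S'' => v ≫ g) ∧
      (∀ g : C' ⟶ S'',
        (shiftFunctor (DerivedCategory (ModuleCat Aᵐᵒᵖ)) (-1 : ℤ)).map f ≫ v ≫ g = 0) ∧
      (∀ h : S⟦(-1 : ℤ)⟧ ⟶ S'',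
        (shiftFunctor (DerivedCategory (ModuleCat Aᵐᵒᵖ)) (-1 : ℤ)).map f ≫ h = 0 →
          ∃ g : C' ⟶ S'', v ≫ g = h) := by
  intro S'' hS''
  refine ⟨?_, ?_, ?_⟩
  · have key : ∀ g : C' ⟶ S'', v ≫ g = 0 → g = 0 := by
      intro g hg
      obtain ⟨k, hk⟩ := Triangle.yoneda_exact₃ _ hT g hg
      change C⟦(-1 : ℤ)⟧⟦(1 : ℤ)⟧ ⟶ S'' at k
      change g = w ≫ k at hk
      obtain ⟨g', hg'⟩ := hf.1.2 S'' hS''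
        ((shiftFunctorCompIsoId (DerivedCategory (ModuleCat Aᵐᵒᵖ)) (-1 : ℤ) 1
            (by norm_num)).inv.app C ≫ k)
      have hz : w ≫ (shiftFunctor (DerivedCategory (ModuleCat Aᵐᵒᵖ)) (1 : ℤ)).map
          ((shiftFunctor (DerivedCategory (ModuleCat Aᵐᵒᵖ)) (-1 : ℤ)).map f) = 0 :=
        comp_distTriang_mor_zero₃₁ _ hT
      have nat := (shiftFunctorCompIsoId (DerivedCategory (ModuleCat Aᵐᵒᵖ)) (-1 : ℤ) 1
            (by norm_num)).hom.naturality f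
      dsimp at nat
      have hk2 : k = (shiftFunctorCompIsoId (DerivedCategory (ModuleCat Aᵐᵒᵖ)) (-1 : ℤ) 1
            (by norm_num)).hom.app C ≫ f ≫ g' := by
        rw [hg', Iso.hom_inv_id_app_assoc]
      rw [hk, hk2, ← Category.assoc _ f g', ← nat, Category.assoc, ← Category.assoc w, hz,
        Limits.zero_comp]
    intro g₁ g₂ h
    rw [← sub_eq_zero]
    apply key
    rw [Preadditive.comp_sub, sub_eq_zero]
    exact h
  · intro g
    have hz : (shiftFunctor (DerivedCategory (ModuleCat Aᵐᵒᵖ)) (-1 : ℤ)).map f ≫ v = 0 :=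
      comp_distTriang_mor_zero₁₂ _ hT
    rw [← Category.assoc, hz, Limits.zero_comp]
  · intro h hh
    obtain ⟨g, hg⟩ := Triangle.yoneda_exact₂ _ hT h hh
    exact ⟨g, hg.symm⟩
end
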